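/- Consider the diluted mixed p-spin model and assume λ > 1. For both the continuous and the discrete perturbation, there exists a constant C > 0 depending only on (α_p)_{2≤p≤Δ} such that for all N, all t ≥ 0, and all 0 ≤ β < ∞, E⟨R(σ,τ)²⟩_t ≤ C / N^{t/(t + 2 log λ)}, where E is taken over both the randomness of the hypergraph and the disorder. -/

import Mathlib

open MeasureTheory ProbabilityTheory Real Finset

noncomputable section

/-! ### Basic objects: spins, Hermite polynomials, Gaussian measures -/

/-- The `±1` spin value attached to a Boolean. -/
def spin (b : Bool) : ℝ := if b then 1 else -1

/-- Normalized Hermite polynomial `h_m = He_m / √(m!)`,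
orthonormal w.r.t. the standard Gaussian measure. -/
def hermiteFn (m : ℕ) (x : ℝ) : ℝ :=
  Polynomial.aeval x (Polynomial.hermite m) / Real.sqrt (Nat.factorial m)

/-- The law of a family of i.i.d. standard Gaussians over a finite index set. -/
def gaussianPi (ι : Type*) [Fintype ι] : Measure (ι → ℝ) :=
  Measure.pi fun _ => gaussianReal 0 1

instance (ι : Type*) [Fintype ι] : IsProbabilityMeasure (gaussianPi ι) := by
  unfold gaussianPi; infer_instance

/-- Tensorized normalized Hermite polynomial `h_n(x) = ∏_e h_{n_e}(x_e)`. -/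
def hermiteProd {ι : Type*} [Fintype ι] (n : ι → ℕ) (x : ι → ℝ) : ℝ :=
  ∏ e, hermiteFn (n e) (x e)

/-- Continuous perturbation `J(t) = e^{-t} J + √(1-e^{-2t}) J'` of the disorder. -/
def contPerturb {ι : Type*} (t : ℝ) (J J' : ι → ℝ) : ι → ℝ := fun e =>
  Real.exp (-t) * J e + Real.sqrt (1 - Real.exp (-2 * t)) * J' e

/-- Discrete perturbation `J(t)_e = B_e J_e + (1-B_e) J'_e` of the disorder. -/
def discPerturb {ι : Type*} (J J' : ι → ℝ) (B : ι → Bool) : ι → ℝ := fun e =>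
  if B e then J e else J' e

/-- Bernoulli measure on `Bool` with success probability `p`. -/
def berBool (p : ℝ) : Measure Bool :=
  ENNReal.ofReal p • Measure.dirac true + ENNReal.ofReal (1 - p) • Measure.dirac false

instance (p : ℝ) : IsFiniteMeasure (berBool p) := by
  constructor
  simp only [berBool, Measure.coe_add, Pi.add_apply, Measure.smul_apply, smul_eq_mul,
    Measure.dirac_apply' _ MeasurableSet.univ, Set.indicator_univ, Pi.one_apply, mul_one]
  exact ENNReal.add_lt_top.mpr ⟨ENNReal.ofReal_lt_top, ENNReal.ofReal_lt_top⟩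

/-- Product Gaussian measure for a pair `(J, J')` of independent disorders. -/
def pairGauss (ι : Type*) [Fintype ι] : Measure ((ι → ℝ) × (ι → ℝ)) :=
  (gaussianPi ι).prod (gaussianPi ι)

/-- Product Gaussian measure for a triple of independent disorders. -/
def tripleGauss (ι : Type*) [Fintype ι] : Measure ((ι → ℝ) × (ι → ℝ) × (ι → ℝ)) :=
  (gaussianPi ι).prod ((gaussianPi ι).prod (gaussianPi ι))

/-- Law of `(J, J', B)`: two independent Gaussian disorders together with i.i.d.
Bernoulli(`p`) variables. -/
def tripleGaussBer (ι : Type*) [Fintype ι] (p : ℝ) :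
    Measure ((ι → ℝ) × (ι → ℝ) × (ι → Bool)) :=
  (gaussianPi ι).prod ((gaussianPi ι).prod (Measure.pi fun _ => berBool p))

/-! ### Spin models on hypergraphs -/

variable {N : ℕ}

/-- `σ_e = ∏_{v ∈ e} σ_v`. -/
def sigEdge (σ : Fin N → Bool) (e : Finset (Fin N)) : ℝ := ∏ v ∈ e, spin (σ v)

/-- Hamiltonian `H_J(σ) = Σ_e ρ_{|e|}(J_e) σ_e` of the short-range model. -/
def ham (Edges : Finset (Finset (Fin N))) (ρ : ℕ → ℝ → ℝ)
    (J : Finset (Fin N) → ℝ) (σ : Fin N → Bool) : ℝ :=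
  ∑ e ∈ Edges, ρ e.card (J e) * sigEdge σ e

/-- Gibbs average of an observable `f` for the Hamiltonian `H` at inverse temperature `β`. -/
def gibbs (β : ℝ) (H : (Fin N → Bool) → ℝ) (f : (Fin N → Bool) → ℝ) : ℝ :=
  (∑ σ : Fin N → Bool, f σ * Real.exp (β * H σ)) / ∑ σ : Fin N → Bool, Real.exp (β * H σ)

/-- Gibbs average of a two-replica observable `f(σ,τ)` where `σ, τ` are sampled from the
product of the Gibbs measures of the Hamiltonians `H₁`, `H₂`. -/
def gibbs2 (β : ℝ) (H₁ H₂ : (Fin N → Bool) → ℝ)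
    (f : (Fin N → Bool) → (Fin N → Bool) → ℝ) : ℝ :=
  (∑ σ : Fin N → Bool, ∑ τ : Fin N → Bool, f σ τ * Real.exp (β * H₁ σ + β * H₂ τ)) /
    ∑ σ : Fin N → Bool, ∑ τ : Fin N → Bool, Real.exp (β * H₁ σ + β * H₂ τ)

/-- Site overlap `R(σ,τ) = N⁻¹ Σ_i σ_i τ_i`. -/
def overlap (σ τ : Fin N → Bool) : ℝ := (∑ i, spin (σ i) * spin (τ i)) / N

/-- Fourier–Hermite coefficient `φ̂_{ij}(n) = E[⟨σ_i σ_j⟩ h_n(J)]` of the two-point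
correlation function. -/
def twoPointCoeff (Edges : Finset (Finset (Fin N))) (ρ : ℕ → ℝ → ℝ) (β : ℝ)
    (i j : Fin N) (n : Finset (Fin N) → ℕ) : ℝ :=
  ∫ ω, gibbs β (ham Edges ρ ω) (fun σ => spin (σ i) * spin (σ j)) * hermiteProd n ω
    ∂gaussianPi (Finset (Fin N))

/-- `E(n) = {e : n_e > 0}`. -/
def Esupp (n : Finset (Fin N) → ℕ) : Finset (Finset (Fin N)) :=
  Finset.univ.filter fun e => n e ≠ 0

/-- `V(n)`: the vertices covered by `E(n)`. -/
def Vsupp (n : Finset (Fin N) → ℕ) : Finset (Fin N) :=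
  (Esupp n).biUnion id

/-- Disorder-averaged two-replica observable under the continuous perturbation:
`E ⟨f(σ,τ)⟩_t` with `σ ~ G_J`, `τ ~ G_{J(t)}`. -/
def contExp (Edges : Finset (Finset (Fin N))) (ρ : ℕ → ℝ → ℝ) (β t : ℝ)
    (f : (Fin N → Bool) → (Fin N → Bool) → ℝ) : ℝ :=
  ∫ ω : (Finset (Fin N) → ℝ) × (Finset (Fin N) → ℝ),
    gibbs2 β (ham Edges ρ ω.1) (ham Edges ρ (contPerturb t ω.1 ω.2)) f
    ∂pairGauss (Finset (Fin N))

/-- Disorder-averaged two-replica observable under the discrete perturbation. -/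
def discExp (Edges : Finset (Finset (Fin N))) (ρ : ℕ → ℝ → ℝ) (β t : ℝ)
    (f : (Fin N → Bool) → (Fin N → Bool) → ℝ) : ℝ :=
  ∫ ω : (Finset (Fin N) → ℝ) × (Finset (Fin N) → ℝ) × (Finset (Fin N) → Bool),
    gibbs2 β (ham Edges ρ ω.1) (ham Edges ρ (discPerturb ω.1 ω.2.1 ω.2.2)) f
    ∂tripleGaussBer (Finset (Fin N)) (Real.exp (-t))

/-! ### Berge paths, distance, balls, cycles -/

/-- `(vs, es)` is a Berge path of length `ℓ` from `v` to `w` in the hypergraph `Edges`. -/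
def IsBergePath (Edges : Finset (Finset (Fin N))) (ℓ : ℕ)
    (vs : Fin (ℓ + 1) → Fin N) (es : Fin ℓ → Finset (Fin N)) (v w : Fin N) : Prop :=
  Function.Injective vs ∧ Function.Injective es ∧ (∀ k, es k ∈ Edges) ∧
    vs 0 = v ∧ vs (Fin.last ℓ) = w ∧
    ∀ k : Fin ℓ, vs k.castSucc ∈ es k ∧ vs k.succ ∈ es k

/-- Hypergraph (Berge) distance between two vertices, `∞` if there is no path. -/
def hdist (Edges : Finset (Finset (Fin N))) (v w : Fin N) : ℕ∞ :=
  sInf {d : ℕ∞ | ∃ (ℓ : ℕ) (vs : Fin (ℓ + 1) → Fin N) (es : Fin ℓ → Finset (Fin N)),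
    IsBergePath Edges ℓ vs es v w ∧ d = (ℓ : ℕ∞)}

open scoped Classical in
/-- The closed ball `B_r(v)` in the hypergraph distance. -/
def hball (Edges : Finset (Finset (Fin N))) (v : Fin N) (r : ℕ) : Finset (Fin N) :=
  Finset.univ.filter fun w => hdist Edges v w ≤ (r : ℕ∞)

/-- The hypergraph `Edges` contains a Berge cycle. -/
def HasBergeCycle (Edges : Finset (Finset (Fin N))) : Prop :=
  ∃ (ℓ : ℕ) (vs : Fin ℓ → Fin N) (es : Fin ℓ → Finset (Fin N)),
    2 ≤ ℓ ∧ Function.Injective vs ∧ Function.Injective es ∧ (∀ k, es k ∈ Edges) ∧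
      ∀ k : Fin ℓ, vs k ∈ es k ∧ vs (finRotate ℓ k) ∈ es k

/-- `min(d, c)` where `d ∈ ℕ∞` and `c ∈ ℝ` (equal to `c` if `d = ∞`). -/
def truncMin (d : ℕ∞) (c : ℝ) : ℝ :=
  if d = ⊤ then c else min (d.toNat : ℝ) c

/-! ### The diluted mixed p-spin random hypergraph -/

/-- Probability that a given hyperedge is present in the diluted model. -/
def edgeProb (α : ℕ → ℝ) (Δ N : ℕ) (e : Finset (Fin N)) : ℝ :=
  if 2 ≤ e.card ∧ e.card ≤ Δ then α e.card * N / (N.choose e.card) else 0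

/-- The law of the diluted mixed `p`-spin random hypergraph: each hyperedge `e` with
`2 ≤ |e| ≤ Δ` is present independently with probability `α_{|e|} N / C(N,|e|)`. -/
def graphMeasure (α : ℕ → ℝ) (Δ N : ℕ) : Measure (Finset (Fin N) → Bool) :=
  Measure.pi fun e => berBool (edgeProb α Δ N e)

/-- The (random) hyperedge set determined by the indicator `g`. -/
def edgesOf {N : ℕ} (Δ : ℕ) (g : Finset (Fin N) → Bool) : Finset (Finset (Fin N)) :=
  Finset.univ.filter fun e => g e = true ∧ 2 ≤ e.card ∧ e.card ≤ Δ

/-- `λ = Σ_p p(p-1) α_p`. -/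
def lamMix (α : ℕ → ℝ) (Δ : ℕ) : ℝ :=
  ∑ p ∈ Finset.Icc 2 Δ, (p : ℝ) * ((p : ℝ) - 1) * α p

/-- `λ' = Σ_p p(p-1)(p-2) α_p`. -/
def lamMix' (α : ℕ → ℝ) (Δ : ℕ) : ℝ :=
  ∑ p ∈ Finset.Icc 2 Δ, (p : ℝ) * ((p : ℝ) - 1) * ((p : ℝ) - 2) * α p

/-- The exploration (breadth-first search) process `(R_t, I_t, S_t, E_t)` of a hypergraph
started at the vertex `i`. -/
def explore {N : ℕ} (Edges : Finset (Finset (Fin N))) (i : Fin N) :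
    ℕ → Finset (Fin N) × Finset (Fin N) × Finset (Fin N) × Finset (Finset (Fin N))
  | 0 => (∅, {i}, Finset.univ.erase i, ∅)
  | t + 1 =>
      let P := explore Edges i t
      let Enew := Edges.filter fun e => (e ∩ P.2.1).Nonempty ∧ e ∩ P.1 = ∅
      (P.1 ∪ P.2.1, Enew.biUnion fun e => e ∩ P.2.2.1,
        P.2.2.1 \ Enew.biUnion fun e => e ∩ P.2.2.1, Enew)

/-- The set `I_t` of newly explored vertices at step `t`. -/
def Iset {N : ℕ} (Edges : Finset (Finset (Fin N))) (i : Fin N) (t : ℕ) : Finset (Fin N) :=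
  (explore Edges i t).2.1

/-- Disorder-and-graph-averaged two-replica observable under the continuous perturbation
in the diluted model. -/
def dilContExp (α : ℕ → ℝ) (Δ N : ℕ) (ρ : ℕ → ℝ → ℝ) (β t : ℝ)
    (f : (Fin N → Bool) → (Fin N → Bool) → ℝ) : ℝ :=
  ∫ ω : (Finset (Fin N) → Bool) × (Finset (Fin N) → ℝ) × (Finset (Fin N) → ℝ),
    gibbs2 β (ham (edgesOf Δ ω.1) ρ ω.2.1)
      (ham (edgesOf Δ ω.1) ρ (contPerturb t ω.2.1 ω.2.2)) f
    ∂((graphMeasure α Δ N).prod (pairGauss (Finset (Fin N))))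

/-- Disorder-and-graph-averaged two-replica observable under the discrete perturbation
in the diluted model. -/
def dilDiscExp (α : ℕ → ℝ) (Δ N : ℕ) (ρ : ℕ → ℝ → ℝ) (β t : ℝ)
    (f : (Fin N → Bool) → (Fin N → Bool) → ℝ) : ℝ :=
  ∫ ω : (Finset (Fin N) → Bool) ×
      (Finset (Fin N) → ℝ) × (Finset (Fin N) → ℝ) × (Finset (Fin N) → Bool),
    gibbs2 β (ham (edgesOf Δ ω.1) ρ ω.2.1)
      (ham (edgesOf Δ ω.1) ρ (discPerturb ω.2.1 ω.2.2.1 ω.2.2.2)) f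
    ∂((graphMeasure α Δ N).prod (tripleGaussBer (Finset (Fin N)) (Real.exp (-t))))

/-! ### The Lévy model -/

/-- Hamiltonian of the Lévy model: `H(σ) = a_N⁻¹ Σ_{i,j} ρ(J_{ij}) σ_i σ_j`. -/
def levyHam (N : ℕ) (aN : ℝ) (ρ : ℝ → ℝ) (J : Fin N × Fin N → ℝ) (σ : Fin N → Bool) : ℝ :=
  (∑ p : Fin N × Fin N, ρ (J p) * (spin (σ p.1) * spin (σ p.2))) / aN

/-- The normalization `a_N = inf{x > 0 : P(|ρ(J)| > x) ≤ 1/N}`. -/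
def levyAN (ρ : ℝ → ℝ) (N : ℕ) : ℝ :=
  sInf {x : ℝ | 0 < x ∧ ((gaussianReal 0 1) {j | x < |ρ j|}).toReal ≤ 1 / N}

/-- The coupled free energy `F_N(t,λ)` of the Lévy model, with the two systems
perturbed by the Ornstein–Uhlenbeck flow at time `t`. -/
def levyF (N : ℕ) (β aN lam : ℝ) (ρ : ℝ → ℝ) (t : ℝ) : ℝ :=
  (∫ ω : (Fin N × Fin N → ℝ) × (Fin N × Fin N → ℝ) × (Fin N × Fin N → ℝ),
      Real.log (∑ σ : Fin N → Bool, ∑ τ : Fin N → Bool,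
        Real.exp (β * levyHam N aN ρ (fun p => Real.exp (-t / 2) * ω.1 p +
              Real.sqrt (1 - Real.exp (-t)) * ω.2.1 p) σ +
          β * levyHam N aN ρ (fun p => Real.exp (-t / 2) * ω.1 p +
              Real.sqrt (1 - Real.exp (-t)) * ω.2.2 p) τ +
          lam * N * overlap σ τ ^ 2))
    ∂tripleGauss (Fin N × Fin N)) / N

/-- The coupled free energy `F_N(∞,λ)`: the two systems carry independent disorders. -/
def levyFinf (N : ℕ) (β aN lam : ℝ) (ρ : ℝ → ℝ) : ℝ :=
  (∫ ω : (Fin N × Fin N → ℝ) × (Fin N × Fin N → ℝ) × (Fin N × Fin N → ℝ),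
      Real.log (∑ σ : Fin N → Bool, ∑ τ : Fin N → Bool,
        Real.exp (β * levyHam N aN ρ ω.2.1 σ + β * levyHam N aN ρ ω.2.2 τ +
          lam * N * overlap σ τ ^ 2))
    ∂tripleGauss (Fin N × Fin N)) / N

/-- `φ(t) = Σ_r E[L_r(J¹(t)) L_r(J²(t))]` where `J^i(t) = e^{-t/2} J + √(1-e^{-t}) J^i`. -/
def phiFn (k m : ℕ) (L : Fin m → (Fin k → ℝ) → ℝ) (t : ℝ) : ℝ :=
  ∑ r : Fin m, ∫ ω : (Fin k → ℝ) × (Fin k → ℝ) × (Fin k → ℝ),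
    L r (fun l => Real.exp (-t / 2) * ω.1 l + Real.sqrt (1 - Real.exp (-t)) * ω.2.1 l) *
      L r (fun l => Real.exp (-t / 2) * ω.1 l + Real.sqrt (1 - Real.exp (-t)) * ω.2.2 l)
    ∂tripleGauss (Fin k)

/-! ### Sign flips and the Walsh decomposition -/

section Walsh

variable {ι : Type*}

/-- Flip the signs of the coordinates of `x` according to `s`. -/
def signFlip (s : ι → ℤˣ) (x : ι → ℝ) : ι → ℝ := fun e => ((s e : ℤ) : ℝ) * x e

/-- The Walsh character `s ↦ ∏_{e ∈ A} s_e`. -/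
def walsh (A : Finset ι) (s : ι → ℤˣ) : ℝ := ∏ e ∈ A, ((s e : ℤ) : ℝ)

lemma unit_cast_mul_self (u : ℤˣ) : ((u : ℤ) : ℝ) * ((u : ℤ) : ℝ) = 1 := by
  rcases Int.units_eq_one_or u with h | h <;> simp [h]

lemma abs_unit_cast (u : ℤˣ) : |((u : ℤ) : ℝ)| = 1 := by
  rcases Int.units_eq_one_or u with h | h <;> simp [h]

lemma signFlip_mul (s u : ι → ℤˣ) (x : ι → ℝ) :
    signFlip (s * u) x = signFlip s (signFlip u x) := by
  ext e
  simp [signFlip, mul_assoc]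

lemma signFlip_comm (s u : ι → ℤˣ) (x : ι → ℝ) :
    signFlip s (signFlip u x) = signFlip u (signFlip s x) := by
  rw [← signFlip_mul, mul_comm, signFlip_mul]

lemma walsh_mul (A : Finset ι) (s u : ι → ℤˣ) : walsh A (s * u) = walsh A s * walsh A u := by
  simp [walsh, Finset.prod_mul_distrib]

lemma walsh_mul_self (A : Finset ι) (s : ι → ℤˣ) : walsh A s * walsh A s = 1 := by
  rw [walsh, ← Finset.prod_mul_distrib]
  exact Finset.prod_eq_one fun e _ => unit_cast_mul_self _

lemma abs_walsh (A : Finset ι) (s : ι → ℤˣ) : |walsh A s| = 1 := by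
  rw [walsh, Finset.abs_prod]
  exact Finset.prod_eq_one fun e _ => abs_unit_cast _

lemma measurable_signFlip (s : ι → ℤˣ) : Measurable (signFlip s) := by
  unfold signFlip
  fun_prop

variable [Fintype ι]

/-- The component of `φ` that is odd in the coordinates in `A` and even in the others. -/
def walshComp [DecidableEq ι] (A : Finset ι) (φ : (ι → ℝ) → ℝ) (x : ι → ℝ) : ℝ :=
  (∑ s : ι → ℤˣ, walsh A s * φ (signFlip s x)) / 2 ^ Fintype.card ι

lemma sum_walsh_mul_walsh (s u : ι → ℤˣ) :
    ∑ A : Finset ι, walsh A s * walsh A u = if s = u then 2 ^ Fintype.card ι else 0 := by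
  have h : ∑ A : Finset ι, walsh A s * walsh A u
      = ∏ e : ι, (1 + ((s e : ℤ) : ℝ) * ((u e : ℤ) : ℝ)) := by
    rw [Finset.prod_one_add, Finset.powerset_univ]
    simp [walsh, Finset.prod_mul_distrib]
  rw [h]
  split_ifs with hsu
  · subst hsu
    simp only [unit_cast_mul_self, Finset.prod_const, Finset.card_univ]
    norm_num
  · obtain ⟨e, he⟩ := Function.ne_iff.1 hsu
    refine Finset.prod_eq_zero (Finset.mem_univ e) ?_
    rcases Int.units_eq_one_or (s e) with h1 | h1 <;>
      rcases Int.units_eq_one_or (u e) with h2 | h2 <;> simp_all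

variable [DecidableEq ι]

lemma card_signs : Fintype.card (ι → ℤˣ) = 2 ^ Fintype.card ι := by
  simp

lemma walshComp_signFlip (A : Finset ι) (φ : (ι → ℝ) → ℝ) (u : ι → ℤˣ) (x : ι → ℝ) :
    walshComp A φ (signFlip u x) = walsh A u * walshComp A φ x := by
  unfold walshComp
  rw [← mul_div_assoc, Finset.mul_sum]
  congr 1
  refine Fintype.sum_equiv (Equiv.mulRight u) _ _ fun s => ?_
  rw [Equiv.coe_mulRight, walsh_mul, signFlip_mul, mul_comm (walsh A s) (walsh A u),
    ← mul_assoc, ← mul_assoc, walsh_mul_self, one_mul]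

lemma walshComp_eq_zero {A : Finset ι} {φ : (ι → ℝ) → ℝ} {u : ι → ℤˣ} {c : ℝ}
    (hφ : ∀ x, φ (signFlip u x) = c * φ x) (hc : walsh A u ≠ c) (x : ι → ℝ) :
    walshComp A φ x = 0 := by
  have h1 := walshComp_signFlip A φ u x
  have h2 : walshComp A φ (signFlip u x) = c * walshComp A φ x := by
    unfold walshComp
    rw [← mul_div_assoc, Finset.mul_sum]
    congr 1
    refine Finset.sum_congr rfl fun s _ => ?_
    rw [signFlip_comm, hφ]
    ring
  have h3 : (walsh A u - c) * walshComp A φ x = 0 := by rw [sub_mul, ← h1, ← h2, sub_self]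
  exact (mul_eq_zero.1 h3).resolve_left (sub_ne_zero.2 hc)

lemma abs_walshComp_le (A : Finset ι) {φ : (ι → ℝ) → ℝ} (hφ : ∀ x, |φ x| ≤ 1) (x : ι → ℝ) :
    |walshComp A φ x| ≤ 1 := by
  unfold walshComp
  rw [abs_div, abs_of_pos (by positivity : (0 : ℝ) < 2 ^ Fintype.card ι), div_le_one (by positivity)]
  calc |∑ s : ι → ℤˣ, walsh A s * φ (signFlip s x)|
      ≤ ∑ s : ι → ℤˣ, |walsh A s * φ (signFlip s x)| := Finset.abs_sum_le_sum_abs _ _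
    _ ≤ ∑ s : ι → ℤˣ, (1 : ℝ) := by
        gcongr with s
        rw [abs_mul, abs_walsh, one_mul]
        exact hφ _
    _ = 2 ^ Fintype.card ι := by
        rw [Finset.sum_const, Finset.card_univ, card_signs]
        simp

lemma measurable_walshComp (A : Finset ι) {φ : (ι → ℝ) → ℝ} (hφ : Measurable φ) :
    Measurable (walshComp A φ) := by
  unfold walshComp
  refine Measurable.div_const (Finset.measurable_fun_sum _ fun s _ => ?_) _
  exact (hφ.comp (measurable_signFlip s)).const_mul _

lemma sum_walshComp_mul_walshComp (φ : (ι → ℝ) → ℝ) (x y : ι → ℝ) :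
    ∑ A : Finset ι, walshComp A φ x * walshComp A φ y
      = (∑ s : ι → ℤˣ, φ (signFlip s x) * φ (signFlip s y)) / 2 ^ Fintype.card ι := by
  have h : ∀ A : Finset ι, walshComp A φ x * walshComp A φ y
      = ∑ s : ι → ℤˣ, ∑ u : ι → ℤˣ, (walsh A s * walsh A u) *
          (φ (signFlip s x) * φ (signFlip u y) / (2 ^ Fintype.card ι * 2 ^ Fintype.card ι)) := by
    intro A
    unfold walshComp
    rw [div_mul_div_comm, Finset.sum_mul_sum, Finset.sum_div]
    refine Finset.sum_congr rfl fun s _ => ?_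
    rw [Finset.sum_div]
    refine Finset.sum_congr rfl fun u _ => ?_
    ring
  simp_rw [h]
  rw [Finset.sum_comm, Finset.sum_div]
  refine Finset.sum_congr rfl fun s _ => ?_
  rw [Finset.sum_comm]
  simp_rw [← Finset.sum_mul, sum_walsh_mul_walsh]
  simp only [ite_mul, zero_mul, Finset.sum_ite_eq, Finset.mem_univ, if_true]
  field_simp

end Walsh

/-! ### Noise bounds from the Walsh decomposition -/

section Noise

variable {ι : Type*} [Fintype ι]

lemma measurePreserving_signFlip (s : ι → ℤˣ) :
    MeasurePreserving (signFlip s) (gaussianPi ι) (gaussianPi ι) := by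
  refine measurePreserving_pi _ _ fun e => ⟨by fun_prop, ?_⟩
  rcases Int.units_eq_one_or (s e) with h | h
  · have : (fun x : ℝ => ((s e : ℤ) : ℝ) * x) = id := by ext x; simp [h]
    exact (congrArg (Measure.map · _) this).trans Measure.map_id
  · have : (fun x : ℝ => ((s e : ℤ) : ℝ) * x) = fun x => -x := by ext x; simp [h]
    exact (congrArg (Measure.map · _) this).trans (by simp [gaussianReal_map_neg])

lemma integral_comp_measurePreserving {Ω Ω' : Type*} [MeasurableSpace Ω] [MeasurableSpace Ω']
    {μ : Measure Ω} {ν : Measure Ω'} {T : Ω → Ω'} (hT : MeasurePreserving T μ ν) {f : Ω' → ℝ}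
    (hf : Measurable f) : ∫ ω, f (T ω) ∂μ = ∫ ω, f ω ∂ν := by
  rw [← hT.map_eq, integral_map hT.measurable.aemeasurable hf.aestronglyMeasurable]

lemma integrable_of_abs_le_one {Ω : Type*} [MeasurableSpace Ω] {μ : Measure Ω} [IsFiniteMeasure μ]
    {f : Ω → ℝ} (hf : Measurable f) (h : ∀ x, |f x| ≤ 1) : Integrable f μ :=
  Integrable.of_bound hf.aestronglyMeasurable 1 (ae_of_all _ h)

lemma abs_mul_le_one {a b : ℝ} (ha : |a| ≤ 1) (hb : |b| ≤ 1) : |a * b| ≤ 1 := by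
  rw [abs_mul]
  exact mul_le_one₀ ha (abs_nonneg b) hb

lemma integral_mul_eq_sum_walshComp [DecidableEq ι] {Ω : Type*} [MeasurableSpace Ω]
    {μ : Measure Ω} [IsProbabilityMeasure μ] {X Y : Ω → ι → ℝ}
    (hX : Measurable X) (hY : Measurable Y)
    (hflip : ∀ s : ι → ℤˣ, ∃ T : Ω → Ω, MeasurePreserving T μ μ ∧
      ∀ ω, X (T ω) = signFlip s (X ω) ∧ Y (T ω) = signFlip s (Y ω))
    {φ : (ι → ℝ) → ℝ} (hφ : Measurable φ) (hφ1 : ∀ x, |φ x| ≤ 1) :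
    ∫ ω, φ (X ω) * φ (Y ω) ∂μ
      = ∑ A : Finset ι, ∫ ω, walshComp A φ (X ω) * walshComp A φ (Y ω) ∂μ := by
  have hs : ∀ s : ι → ℤˣ, ∫ ω, φ (signFlip s (X ω)) * φ (signFlip s (Y ω)) ∂μ
      = ∫ ω, φ (X ω) * φ (Y ω) ∂μ := by
    intro s
    obtain ⟨T, hT, hTs⟩ := hflip s
    have hmeas : Measurable fun ω => φ (X ω) * φ (Y ω) := (hφ.comp hX).mul (hφ.comp hY)
    rw [← integral_comp_measurePreserving hT hmeas]
    simp_rw [(hTs _).1, (hTs _).2]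
  rw [← integral_finsetSum]
  · simp_rw [sum_walshComp_mul_walshComp]
    rw [integral_div, integral_finsetSum]
    · simp_rw [hs]
      rw [Finset.sum_const, Finset.card_univ, card_signs, nsmul_eq_mul]
      push_cast
      field_simp
    · intro s _
      refine integrable_of_abs_le_one ?_ fun ω => abs_mul_le_one (hφ1 _) (hφ1 _)
      exact ((hφ.comp (measurable_signFlip s)).comp hX).mul
        ((hφ.comp (measurable_signFlip s)).comp hY)
  · intro A _
    refine integrable_of_abs_le_one ?_ fun ω =>
      abs_mul_le_one (abs_walshComp_le A hφ1 _) (abs_walshComp_le A hφ1 _)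
    exact ((measurable_walshComp A hφ).comp hX).mul ((measurable_walshComp A hφ).comp hY)

/-- A pair of random vectors whose joint law is invariant under simultaneous sign flips
and for which each coordinate in which a function is odd contributes a factor `a` to its
correlation, has correlation at most `a ^ m` on functions without low Walsh components. -/
lemma integral_mul_le_pow [DecidableEq ι] {Ω : Type*} [MeasurableSpace Ω] {μ : Measure Ω}
    [IsProbabilityMeasure μ] {X Y : Ω → ι → ℝ}
    (hX : Measurable X) (hY : Measurable Y) {a : ℝ} (ha0 : 0 ≤ a)
    (ha1 : a ≤ 1)
    (hflip : ∀ s : ι → ℤˣ, ∃ T : Ω → Ω, MeasurePreserving T μ μ ∧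
      ∀ ω, X (T ω) = signFlip s (X ω) ∧ Y (T ω) = signFlip s (Y ω))
    (hodd : ∀ (A : Finset ι) (f : (ι → ℝ) → ℝ), Measurable f → (∀ x, |f x| ≤ 1) →
      (∀ u x, f (signFlip u x) = walsh A u * f x) →
      ∫ ω, f (X ω) * f (Y ω) ∂μ ≤ a ^ #A * ∫ x, f x * f x ∂gaussianPi ι)
    {φ : (ι → ℝ) → ℝ} (hφ : Measurable φ) (hφ1 : ∀ x, |φ x| ≤ 1) {m : ℕ}
    (hm : ∀ A : Finset ι, #A < m → ∀ x, walshComp A φ x = 0) :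
    ∫ ω, φ (X ω) * φ (Y ω) ∂μ ≤ a ^ m := by
  have hc1 := fun A => abs_walshComp_le A hφ1
  have hcm := fun A => measurable_walshComp A hφ
  have h1 := integral_mul_eq_sum_walshComp hX hY hflip hφ hφ1
  have h2 := integral_mul_eq_sum_walshComp (μ := gaussianPi ι) measurable_id measurable_id
    (fun s => ⟨signFlip s, measurePreserving_signFlip s, fun _ => ⟨rfl, rfl⟩⟩) hφ hφ1
  rw [h1]
  calc ∑ A : Finset ι, ∫ ω, walshComp A φ (X ω) * walshComp A φ (Y ω) ∂μ
      ≤ ∑ A : Finset ι, a ^ m * ∫ x, walshComp A φ x * walshComp A φ x ∂gaussianPi ι := by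
        refine Finset.sum_le_sum fun A _ => ?_
        by_cases hA : #A < m
        · simp [hm A hA]
        · refine (hodd A _ (hcm A) (hc1 A) (walshComp_signFlip A φ)).trans ?_
          refine mul_le_mul_of_nonneg_right (pow_le_pow_of_le_one ha0 ha1 (not_lt.1 hA)) ?_
          exact integral_nonneg fun x => mul_self_nonneg _
    _ = a ^ m * ∫ x, φ x * φ x ∂gaussianPi ι := by
        rw [← Finset.mul_sum]
        exact congrArg _ h2.symm
    _ ≤ a ^ m * 1 := by
        refine mul_le_mul_of_nonneg_left ?_ (pow_nonneg ha0 m)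
        calc ∫ x, φ x * φ x ∂gaussianPi ι ≤ ∫ _x, (1 : ℝ) ∂gaussianPi ι := by
              refine integral_mono ?_ (integrable_const _) fun x => ?_
              · exact integrable_of_abs_le_one (hφ.mul hφ)
                  fun ω => abs_mul_le_one (hφ1 _) (hφ1 _)
              · exact (le_abs_self _).trans (abs_mul_le_one (hφ1 _) (hφ1 _))
          _ = 1 := by simp
    _ = a ^ m := mul_one _

end Noise

/-! ### Correlation decay under the discrete perturbation -/

lemma isProbabilityMeasure_berBool {p : ℝ} (h0 : 0 ≤ p) (h1 : p ≤ 1) :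
    IsProbabilityMeasure (berBool p) := by
  constructor
  simp only [berBool, Measure.coe_add, Pi.add_apply, Measure.smul_apply, smul_eq_mul,
    measure_univ, mul_one]
  rw [← ENNReal.ofReal_add h0 (by linarith)]
  simp

lemma berBool_singleton_true (p : ℝ) : berBool p {true} = ENNReal.ofReal p := by
  simp [berBool]

lemma pi_berBool_real_subset {ι : Type*} [Fintype ι] {p : ι → ℝ} (h0 : ∀ e, 0 ≤ p e)
    (h1 : ∀ e, p e ≤ 1) (A : Finset ι) :
    (Measure.pi fun e => berBool (p e)).real {B | ∀ e ∈ A, B e = true} = ∏ e ∈ A, p e := by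
  have : ∀ e, IsProbabilityMeasure (berBool (p e)) :=
    fun e => isProbabilityMeasure_berBool (h0 e) (h1 e)
  have hset : {B : ι → Bool | ∀ e ∈ A, B e = true} = Set.pi A fun _ => {true} := by
    ext B
    simp [Set.mem_pi]
  rw [hset, measureReal_def, Measure.pi_pi_finset, ENNReal.toReal_prod]
  refine Finset.prod_congr rfl fun e _ => ?_
  rw [berBool_singleton_true, ENNReal.toReal_ofReal (h0 e)]

section Discrete

variable {ι : Type*}

lemma measurable_discPerturb :
    Measurable fun ω : (ι → ℝ) × (ι → ℝ) × (ι → Bool) => discPerturb ω.1 ω.2.1 ω.2.2 := by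
  unfold discPerturb
  refine measurable_pi_lambda _ fun e => Measurable.ite ?_ (by fun_prop) (by fun_prop)
  have : Measurable fun ω : (ι → ℝ) × (ι → ℝ) × (ι → Bool) => ω.2.2 e := by fun_prop
  exact this (measurableSet_singleton true)

lemma discPerturb_signFlip (s : ι → ℤˣ) (x y : ι → ℝ) (B : ι → Bool) :
    discPerturb (signFlip s x) (signFlip s y) B = signFlip s (discPerturb x y B) := by
  ext e
  by_cases h : B e <;> simp [discPerturb, signFlip, h]

variable [Fintype ι]

lemma measurePreserving_discPerturb (B : ι → Bool) :
    MeasurePreserving (fun q : (ι → ℝ) × (ι → ℝ) => discPerturb q.1 q.2 B)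
      ((gaussianPi ι).prod (gaussianPi ι)) (gaussianPi ι) := by
  have hm : Measurable fun q : (ι → ℝ) × (ι → ℝ) => discPerturb q.1 q.2 B :=
    measurable_discPerturb.comp (by fun_prop : Measurable fun q : (ι → ℝ) × (ι → ℝ) =>
      (q.1, q.2, B))
  refine ⟨hm, ?_⟩
  refine (Measure.pi_eq fun s hs => ?_).symm
  have hpre : (fun q : (ι → ℝ) × (ι → ℝ) => discPerturb q.1 q.2 B) ⁻¹' Set.univ.pi s
      = (Set.univ.pi fun e => if B e then s e else Set.univ) ×ˢ
        (Set.univ.pi fun e => if B e then Set.univ else s e) := by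
    ext q
    simp only [Set.mem_preimage, Set.mem_prod, Set.mem_pi, Set.mem_univ, true_implies,
      discPerturb, ← forall_and]
    refine forall_congr' fun e => ?_
    by_cases h : B e <;> simp [h]
  rw [Measure.map_apply hm (MeasurableSet.univ_pi hs), hpre, Measure.prod_prod, gaussianPi,
    Measure.pi_pi, Measure.pi_pi, ← Finset.prod_mul_distrib]
  refine Finset.prod_congr rfl fun e _ => ?_
  by_cases h : B e <;> simp [h]

lemma integral_discPerturb_mul_le [DecidableEq ι] {a : ℝ} (ha0 : 0 ≤ a) (ha1 : a ≤ 1)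
    (A : Finset ι) {f : (ι → ℝ) → ℝ} (hf : Measurable f) (hf1 : ∀ x, |f x| ≤ 1)
    (hodd : ∀ u x, f (signFlip u x) = walsh A u * f x) :
    ∫ ω, f ω.1 * f (discPerturb ω.1 ω.2.1 ω.2.2) ∂tripleGaussBer ι a
      ≤ a ^ #A * ∫ x, f x * f x ∂gaussianPi ι := by
  have : IsProbabilityMeasure (berBool a) := isProbabilityMeasure_berBool ha0 ha1
  set S := ∫ x, f x * f x ∂gaussianPi ι with hS
  set β : Measure (ι → Bool) := Measure.pi fun _ => berBool a with hβ
  have hsq : ∀ {Z : (ι → ℝ) × (ι → ℝ) → ι → ℝ},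
      MeasurePreserving Z ((gaussianPi ι).prod (gaussianPi ι)) (gaussianPi ι) →
      ∫ q, f (Z q) * f (Z q) ∂((gaussianPi ι).prod (gaussianPi ι)) = S := by
    intro Z hZ
    exact integral_comp_measurePreserving hZ (hf.mul hf)
  have hdm : ∀ B : ι → Bool, Measurable fun q : (ι → ℝ) × (ι → ℝ) => f (discPerturb q.1 q.2 B) :=
    fun B => hf.comp (measurePreserving_discPerturb B).measurable
  have hG : ∀ B : ι → Bool, ∫ q : (ι → ℝ) × (ι → ℝ), f q.1 * f (discPerturb q.1 q.2 B)
      ∂((gaussianPi ι).prod (gaussianPi ι))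
      ≤ Set.indicator {B : ι → Bool | ∀ e ∈ A, B e = true} (fun _ => S) B := by
    intro B
    by_cases hB : ∀ e ∈ A, B e = true
    · rw [Set.indicator_of_mem (by exact hB)]
      have h1 := hsq (Z := Prod.fst) measurePreserving_fst
      have h2 := hsq (measurePreserving_discPerturb B)
      have hi1 : Integrable (fun q : (ι → ℝ) × (ι → ℝ) => f q.1 * f q.1)
          ((gaussianPi ι).prod (gaussianPi ι)) :=
        integrable_of_abs_le_one (by fun_prop) fun _ => abs_mul_le_one (hf1 _) (hf1 _)
      have hi2 : Integrable (fun q : (ι → ℝ) × (ι → ℝ) =>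
          f (discPerturb q.1 q.2 B) * f (discPerturb q.1 q.2 B))
          ((gaussianPi ι).prod (gaussianPi ι)) :=
        integrable_of_abs_le_one ((hdm B).mul (hdm B)) fun _ => abs_mul_le_one (hf1 _) (hf1 _)
      calc ∫ q : (ι → ℝ) × (ι → ℝ), f q.1 * f (discPerturb q.1 q.2 B)
            ∂((gaussianPi ι).prod (gaussianPi ι))
          ≤ ∫ q : (ι → ℝ) × (ι → ℝ), (f q.1 * f q.1 +
              f (discPerturb q.1 q.2 B) * f (discPerturb q.1 q.2 B)) / 2
            ∂((gaussianPi ι).prod (gaussianPi ι)) := by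
            refine integral_mono ?_ ((hi1.add hi2).div_const 2) fun q => ?_
            · exact integrable_of_abs_le_one ((hf.comp measurable_fst).mul (hdm B))
                fun _ => abs_mul_le_one (hf1 _) (hf1 _)
            · have := two_mul_le_add_sq (f q.1) (f (discPerturb q.1 q.2 B))
              nlinarith
        _ = S := by
            rw [integral_div, integral_add hi1 hi2, h1, h2]
            ring
    · rw [Set.indicator_of_notMem (by exact hB)]
      push Not at hB
      obtain ⟨e, heA, heB⟩ := hB
      set u : ι → ℤˣ := Function.update 1 e (-1) with hu
      have hT : MeasurePreserving (Prod.map id (signFlip u))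
          ((gaussianPi ι).prod (gaussianPi ι)) ((gaussianPi ι).prod (gaussianPi ι)) :=
        (MeasurePreserving.id _).prod (measurePreserving_signFlip u)
      have hflip : ∀ q : (ι → ℝ) × (ι → ℝ),
          discPerturb q.1 (signFlip u q.2) B = signFlip u (discPerturb q.1 q.2 B) := by
        intro q
        ext e'
        by_cases h : e' = e
        · subst h
          simp [discPerturb, signFlip, heB]
        · simp [discPerturb, signFlip, hu, h]
      have hw : walsh A u = -1 := by
        rw [walsh, Finset.prod_eq_single_of_mem e heA]
        · simp [hu]
        · intro e' _ h
          simp [hu, h]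
      have hneg : ∫ q : (ι → ℝ) × (ι → ℝ), f q.1 * f (discPerturb q.1 q.2 B)
          ∂((gaussianPi ι).prod (gaussianPi ι))
          = -∫ q : (ι → ℝ) × (ι → ℝ), f q.1 * f (discPerturb q.1 q.2 B)
          ∂((gaussianPi ι).prod (gaussianPi ι)) := by
        refine (integral_comp_measurePreserving hT
          ((hf.comp measurable_fst).mul (hdm B))).symm.trans ?_
        rw [← integral_neg]
        refine integral_congr_ae (ae_of_all _ fun q => ?_)
        simp [hflip, hodd, hw]
      linarith
  have hfull : Integrable (fun ω : (ι → ℝ) × (ι → ℝ) × (ι → Bool) =>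
      f ω.1 * f (discPerturb ω.1 ω.2.1 ω.2.2)) (tripleGaussBer ι a) := by
    unfold tripleGaussBer
    refine integrable_of_abs_le_one ?_ fun _ => abs_mul_le_one (hf1 _) (hf1 _)
    exact (hf.comp measurable_fst).mul (hf.comp measurable_discPerturb)
  have hassoc := measurePreserving_prodAssoc (gaussianPi ι) (gaussianPi ι) β
  have hmeas : Measurable fun ω : (ι → ℝ) × (ι → ℝ) × (ι → Bool) =>
      f ω.1 * f (discPerturb ω.1 ω.2.1 ω.2.2) :=
    (hf.comp measurable_fst).mul (hf.comp measurable_discPerturb)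
  calc ∫ ω, f ω.1 * f (discPerturb ω.1 ω.2.1 ω.2.2) ∂tripleGaussBer ι a
      = ∫ q : ((ι → ℝ) × (ι → ℝ)) × (ι → Bool), f q.1.1 * f (discPerturb q.1.1 q.1.2 q.2)
          ∂(((gaussianPi ι).prod (gaussianPi ι)).prod β) := by
        exact (integral_comp_measurePreserving hassoc hmeas).symm
    _ = ∫ B, ∫ q : (ι → ℝ) × (ι → ℝ), f q.1 * f (discPerturb q.1 q.2 B)
          ∂((gaussianPi ι).prod (gaussianPi ι)) ∂β := by
        rw [integral_prod_symm]
        refine integrable_of_abs_le_one ?_ fun _ => abs_mul_le_one (hf1 _) (hf1 _)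
        exact hmeas.comp hassoc.measurable
    _ ≤ ∫ B, Set.indicator {B : ι → Bool | ∀ e ∈ A, B e = true} (fun _ => S) B ∂β :=
        integral_mono Integrable.of_finite Integrable.of_finite hG
    _ = a ^ #A * S := by
        rw [integral_indicator_const _ (Set.toFinite _).measurableSet, hβ,
          pi_berBool_real_subset (fun _ => ha0) fun _ => ha1]
        simp

/-- A function without Walsh components of order below `m` has correlation at most `a ^ m` under
the discrete perturbation with retention probability `a`. -/
lemma integral_discPerturb_le_pow [DecidableEq ι] {a : ℝ} (ha0 : 0 ≤ a) (ha1 : a ≤ 1)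
    {φ : (ι → ℝ) → ℝ} (hφ : Measurable φ) (hφ1 : ∀ x, |φ x| ≤ 1) {m : ℕ}
    (hm : ∀ A : Finset ι, #A < m → ∀ x, walshComp A φ x = 0) :
    ∫ ω, φ ω.1 * φ (discPerturb ω.1 ω.2.1 ω.2.2) ∂tripleGaussBer ι a ≤ a ^ m := by
  have : IsProbabilityMeasure (berBool a) := isProbabilityMeasure_berBool ha0 ha1
  have : IsProbabilityMeasure (tripleGaussBer ι a) := by unfold tripleGaussBer; infer_instance
  refine integral_mul_le_pow measurable_fst measurable_discPerturb ha0 ha1 (fun s => ?_)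
    (fun A f hf hf1 hodd => integral_discPerturb_mul_le ha0 ha1 A hf hf1 hodd) hφ hφ1 hm
  refine ⟨Prod.map (signFlip s) (Prod.map (signFlip s) id), ?_, fun ω => ⟨rfl, ?_⟩⟩
  · exact (measurePreserving_signFlip s).prod
      ((measurePreserving_signFlip s).prod (MeasurePreserving.id _))
  · exact discPerturb_signFlip _ _ _ _

end Discrete

/-! ### Correlation decay under the continuous perturbation -/

/-- The Mehler kernel: the density of `N(a x, b²)` with respect to `N(0, 1)` when
`a² + b² = 1`. -/
def mehler (a b x y : ℝ) : ℝ :=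
  b⁻¹ * exp ((2 * a * x * y - a ^ 2 * x ^ 2 - a ^ 2 * y ^ 2) / (2 * b ^ 2))

lemma mehler_nonneg {a b : ℝ} (hb : 0 < b) (x y : ℝ) : 0 ≤ mehler a b x y := by
  unfold mehler
  positivity

lemma mehler_comm (a b x y : ℝ) : mehler a b x y = mehler a b y x := by
  unfold mehler
  ring_nf

lemma measurable_mehler (a b : ℝ) : Measurable fun q : ℝ × ℝ => mehler a b q.1 q.2 := by
  unfold mehler
  fun_prop

lemma mehler_neg_le {a b x y : ℝ} (ha : 0 ≤ a) (hb : 0 < b) (hxy : 0 ≤ x * y) :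
    mehler a b x (-y) ≤ mehler a b x y := by
  unfold mehler
  have := mul_nonneg ha hxy
  refine mul_le_mul_of_nonneg_left (exp_le_exp.2 ?_) (inv_nonneg.2 hb.le)
  gcongr ?_ / _
  nlinarith

lemma gaussianReal_withDensity_mehler {a b : ℝ} (hb : 0 < b) (hab : a ^ 2 + b ^ 2 = 1) (x : ℝ) :
    (gaussianReal 0 1).withDensity (fun y => ENNReal.ofReal (mehler a b x y))
      = (gaussianReal 0 1).map fun z => a * x + b * z := by
  have hmap : (gaussianReal 0 1).map (fun z => a * x + b * z)
      = gaussianReal (a * x) (NNReal.mk (b ^ 2) (sq_nonneg b)) := by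
    have h : (fun z : ℝ => a * x + b * z) = (fun z => a * x + z) ∘ (fun z => b * z) := rfl
    rw [h, ← Measure.map_map (by fun_prop) (by fun_prop), gaussianReal_map_const_mul,
      gaussianReal_map_const_add]
    congr 1
    · ring
    · exact mul_one _
  have hv : NNReal.mk (b ^ 2) (sq_nonneg b) ≠ 0 := by
    intro h
    have h' : b ^ 2 = 0 := congrArg NNReal.toReal h
    exact hb.ne' (pow_eq_zero_iff two_ne_zero |>.1 h')
  have hme : Measurable fun y => ENNReal.ofReal (mehler a b x y) :=
    ((measurable_mehler a b).comp (by fun_prop : Measurable fun y : ℝ => (x, y))).ennreal_ofReal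
  rw [hmap, gaussianReal_of_var_ne_zero _ hv, gaussianReal_of_var_ne_zero _ one_ne_zero,
    ← withDensity_mul _ (measurable_gaussianPDF _ _) hme]
  congr 1
  ext y
  simp only [Pi.mul_apply, gaussianPDF]
  rw [← ENNReal.ofReal_mul (gaussianPDFReal_nonneg _ _ _)]
  congr 1
  simp only [gaussianPDFReal, mehler, NNReal.coe_one, NNReal.coe_mk]
  have h2 : √(2 * Real.pi * b ^ 2) = √(2 * Real.pi * 1) * b := by
    rw [mul_one, Real.sqrt_mul (by positivity), Real.sqrt_sq hb.le]
  rw [h2, mul_inv, mul_mul_mul_comm, ← Real.exp_add]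
  congr 2
  field_simp
  linear_combination (-y ^ 2) * hab

section Product

variable {ι : Type*} [Fintype ι]

lemma lintegral_pi_prod {μ : ι → Measure ℝ} [∀ e, IsProbabilityMeasure (μ e)]
    {f : ι → ℝ → ENNReal} (hf : ∀ e, Measurable (f e)) :
    ∫⁻ x, ∏ e, f e (x e) ∂Measure.pi μ = ∏ e, ∫⁻ y, f e y ∂μ e := by
  have h := lintegral_prod_eq_prod_lintegral_of_indepFun (μ := Measure.pi μ) Finset.univ
    (fun e x => f e (x e)) (iIndepFun_pi fun e => (hf e).aemeasurable)
    (fun e => (hf e).comp (measurable_pi_apply e))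
  rw [h]
  refine Finset.prod_congr rfl fun e _ => ?_
  exact (measurePreserving_eval μ e).lintegral_comp (hf e)

lemma pi_withDensity {μ : ι → Measure ℝ} [∀ e, IsProbabilityMeasure (μ e)]
    {ν : ι → Measure ℝ} [∀ e, IsProbabilityMeasure (ν e)]
    {f : ι → ℝ → ENNReal} (hf : ∀ e, Measurable (f e))
    (h : ∀ e, (μ e).withDensity (f e) = ν e) :
    (Measure.pi μ).withDensity (fun x => ∏ e, f e (x e)) = Measure.pi ν := by
  refine (Measure.pi_eq fun s hs => ?_).symm
  rw [withDensity_apply _ (MeasurableSet.univ_pi hs), ← lintegral_indicator (MeasurableSet.univ_pi hs)]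
  have hind : (Set.univ.pi s).indicator (fun x : ι → ℝ => ∏ e, f e (x e))
      = fun x => ∏ e, (s e).indicator (f e) (x e) := by
    ext x
    by_cases hx : x ∈ Set.univ.pi s
    · rw [Set.indicator_of_mem hx]
      exact Finset.prod_congr rfl fun e _ => (Set.indicator_of_mem (hx e trivial) _).symm
    · rw [Set.indicator_of_notMem hx]
      simp only [Set.mem_pi, Set.mem_univ, true_implies, not_forall] at hx
      obtain ⟨e, he⟩ := hx
      exact (Finset.prod_eq_zero (Finset.mem_univ e) (Set.indicator_of_notMem he _)).symm
  rw [hind, lintegral_pi_prod fun e => (hf e).indicator (hs e)]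
  refine Finset.prod_congr rfl fun e _ => ?_
  rw [lintegral_indicator (hs e), ← h e, withDensity_apply _ (hs e)]

/-- The Ornstein–Uhlenbeck step `a x + b z`. -/
def ouMap (a b : ℝ) (x z : ι → ℝ) : ι → ℝ := fun e => a * x e + b * z e

/-- The product Mehler kernel. -/
def mehlerPi (a b : ℝ) (x y : ι → ℝ) : ℝ := ∏ e, mehler a b (x e) (y e)

lemma mehlerPi_nonneg {a b : ℝ} (hb : 0 < b) (x y : ι → ℝ) : 0 ≤ mehlerPi a b x y :=
  Finset.prod_nonneg fun _ _ => mehler_nonneg hb _ _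

lemma mehlerPi_comm (a b : ℝ) (x y : ι → ℝ) : mehlerPi a b x y = mehlerPi a b y x :=
  Finset.prod_congr rfl fun _ _ => mehler_comm _ _ _ _

lemma measurable_mehlerPi (a b : ℝ) :
    Measurable fun q : (ι → ℝ) × (ι → ℝ) => mehlerPi a b q.1 q.2 := by
  unfold mehlerPi mehler
  fun_prop

lemma measurable_mehlerPi_right (a b : ℝ) (x : ι → ℝ) : Measurable (mehlerPi a b x) := by
  unfold mehlerPi mehler
  fun_prop

lemma gaussianPi_withDensity_mehlerPi {a b : ℝ} (hb : 0 < b) (hab : a ^ 2 + b ^ 2 = 1)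
    (x : ι → ℝ) :
    (gaussianPi ι).withDensity (fun y => ENNReal.ofReal (mehlerPi a b x y))
      = (gaussianPi ι).map (ouMap a b x) := by
  have hm : ∀ e, Measurable fun y => ENNReal.ofReal (mehler a b (x e) y) := fun e =>
    ((measurable_mehler a b).comp (by fun_prop : Measurable fun y : ℝ => (x e, y))).ennreal_ofReal
  have : ∀ e, IsProbabilityMeasure ((gaussianReal 0 1).map fun z => a * x e + b * z) :=
    fun e => Measure.isProbabilityMeasure_map (by fun_prop)
  have h1 : (gaussianPi ι).map (ouMap a b x)
      = Measure.pi fun e => (gaussianReal 0 1).map fun z => a * x e + b * z :=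
    (Measure.pi_map_pi (f := fun e z => a * x e + b * z) fun e => by fun_prop)
  rw [h1, ← pi_withDensity hm fun e => gaussianReal_withDensity_mehler hb hab (x e)]
  unfold gaussianPi mehlerPi
  congr 1
  ext y
  exact ENNReal.ofReal_prod_of_nonneg fun e _ => mehler_nonneg hb _ _

end Product

section Continuous

variable {ι : Type*}

/-- `∏_{e ∈ A} sign x_e`. -/
def signProd (A : Finset ι) (x : ι → ℝ) : ℝ := ∏ e ∈ A, (SignType.sign (x e) : ℝ)

lemma measurable_signProd (A : Finset ι) : Measurable (signProd A) := by
  unfold signProd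
  refine Finset.measurable_fun_prod _ fun e _ => ?_
  have h : Measurable fun r : ℝ => ((SignType.sign r : SignType) : ℝ) := by
    have : (fun r : ℝ => ((SignType.sign r : SignType) : ℝ))
        = fun r => if 0 < r then 1 else if r < 0 then -1 else 0 := by
      ext r
      simp only [sign_apply]
      split_ifs <;> simp
    rw [this]
    exact Measurable.ite measurableSet_Ioi measurable_const
      (Measurable.ite measurableSet_Iio measurable_const measurable_const)
  exact h.comp (measurable_pi_apply e)

lemma abs_signProd_le (A : Finset ι) (x : ι → ℝ) : |signProd A x| ≤ 1 := by
  rw [signProd, Finset.abs_prod]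
  refine Finset.prod_le_one (fun _ _ => abs_nonneg _) fun e _ => ?_
  rcases lt_trichotomy (x e) 0 with h | h | h <;> simp [h, sign_pos]

lemma signProd_signFlip (A : Finset ι) (u : ι → ℤˣ) (x : ι → ℝ) :
    signProd A (signFlip u x) = walsh A u * signProd A x := by
  rw [signProd, signProd, walsh, ← Finset.prod_mul_distrib]
  refine Finset.prod_congr rfl fun e _ => ?_
  rcases Int.units_eq_one_or (u e) with h | h <;> simp [signFlip, h, Left.sign_neg]

lemma signProd_mul_prod_abs (A : Finset ι) (x : ι → ℝ) :
    signProd A x * ∏ e ∈ A, |x e| = ∏ e ∈ A, x e := by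
  rw [signProd, ← Finset.prod_mul_distrib]
  exact Finset.prod_congr rfl fun e _ => sign_mul_abs _

lemma signProd_mul_self {A : Finset ι} {x : ι → ℝ} (h : ∀ e ∈ A, x e ≠ 0) :
    signProd A x * signProd A x = 1 := by
  rw [signProd, ← Finset.prod_mul_distrib]
  refine Finset.prod_eq_one fun e he => ?_
  rcases lt_or_gt_of_ne (h e he) with h | h <;> simp [h, sign_pos]

lemma measurable_ouMap {a b : ℝ} (x : ι → ℝ) : Measurable (ouMap a b x) := by
  unfold ouMap
  fun_prop

variable [Fintype ι]

lemma signProd_mul_sum_mehlerPi_nonneg [DecidableEq ι] {a b : ℝ} (ha : 0 ≤ a) (hb : 0 < b)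
    (A : Finset ι) (x y : ι → ℝ) :
    0 ≤ signProd A x * signProd A y * ∑ u : ι → ℤˣ, walsh A u * mehlerPi a b x (signFlip u y) := by
  have key : signProd A x * signProd A y * ∑ u : ι → ℤˣ, walsh A u * mehlerPi a b x (signFlip u y)
      = ∏ e, ∑ v : ℤˣ, (if e ∈ A then
          ((SignType.sign (x e) : ℝ) * (SignType.sign (y e) : ℝ) * ((v : ℤ) : ℝ)) else 1)
            * mehler a b (x e) (((v : ℤ) : ℝ) * y e) := by
    rw [Finset.prod_univ_sum, Finset.mul_sum, Fintype.piFinset_univ]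
    refine Finset.sum_congr rfl fun u _ => ?_
    rw [Finset.prod_mul_distrib, Finset.prod_ite_mem, Finset.univ_inter, Finset.prod_mul_distrib,
      Finset.prod_mul_distrib, signProd, signProd, walsh, mehlerPi, mul_assoc]
    simp only [signFlip, mul_assoc]
  rw [key]
  refine Finset.prod_nonneg fun e _ => ?_
  have huniv : (Finset.univ : Finset ℤˣ) = {1, -1} := by decide
  rw [huniv, Finset.sum_pair (by decide)]
  by_cases he : e ∈ A
  · have h : 0 ≤ ((SignType.sign (x e) : ℝ) * (SignType.sign (y e) : ℝ)) *
        (mehler a b (x e) (y e) - mehler a b (x e) (-(y e))) := by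
      have hs : (SignType.sign (x e) : ℝ) * (SignType.sign (y e) : ℝ)
          = (SignType.sign (x e * y e) : ℝ) := by
        rw [sign_mul]
        simp
      rw [hs]
      rcases lt_trichotomy (x e * y e) 0 with hxy | hxy | hxy
      · have := mehler_neg_le ha hb (x := x e) (y := -(y e)) (by linarith)
        rw [neg_neg] at this
        simp only [sign_neg hxy, SignType.coe_neg_one]
        linarith
      · simp [hxy]
      · have := mehler_neg_le ha hb hxy.le
        simp only [sign_pos hxy, SignType.coe_one]
        linarith
    simp only [he, if_true]
    push_cast
    rw [one_mul, neg_one_mul]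
    linarith
  · simp only [he, if_false, one_mul]
    exact add_nonneg (mehler_nonneg hb _ _) (mehler_nonneg hb _ _)

lemma integral_mehlerPi_mul {a b : ℝ} (hb : 0 < b) (hab : a ^ 2 + b ^ 2 = 1) (x : ι → ℝ)
    {F : (ι → ℝ) → ℝ} (hF : Measurable F) :
    ∫ y, mehlerPi a b x y * F y ∂gaussianPi ι
      = ∫ z, F (ouMap a b x z) ∂gaussianPi ι := by
  have hm : Measurable (ouMap a b x) := measurable_ouMap x
  have hM := measurable_mehlerPi_right a b x
  rw [← integral_map hm.aemeasurable hF.aestronglyMeasurable,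
    ← gaussianPi_withDensity_mehlerPi hb hab,
    integral_withDensity_eq_integral_toReal_smul hM.ennreal_ofReal (by simp)]
  refine integral_congr_ae (ae_of_all _ fun y => ?_)
  simp [ENNReal.toReal_ofReal (mehlerPi_nonneg hb x y)]

lemma integrable_mehlerPi_mul {a b : ℝ} (hb : 0 < b) (hab : a ^ 2 + b ^ 2 = 1) (x : ι → ℝ)
    {F : (ι → ℝ) → ℝ} (hF : Measurable F)
    (hi : Integrable (fun z => F (ouMap a b x z)) (gaussianPi ι)) :
    Integrable (fun y => mehlerPi a b x y * F y) (gaussianPi ι) := by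
  have hm : Measurable (ouMap a b x) := measurable_ouMap x
  have hM := measurable_mehlerPi_right a b x
  have h : Integrable F ((gaussianPi ι).map (ouMap a b x)) :=
    (integrable_map_measure hF.aestronglyMeasurable hm.aemeasurable).2 hi
  rw [← gaussianPi_withDensity_mehlerPi hb hab,
    integrable_withDensity_iff_integrable_smul' hM.ennreal_ofReal (by simp)] at h
  simpa [ENNReal.toReal_ofReal (mehlerPi_nonneg hb x _)] using h

/-- Given the moduli of two positively correlated Gaussian families, the conditional correlation of
the sign products over `A` is nonnegative. -/
lemma signProd_mul_integral_nonneg [DecidableEq ι] {a b : ℝ} (ha : 0 ≤ a) (hb : 0 < b)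
    (hab : a ^ 2 + b ^ 2 = 1) (A : Finset ι) (x : ι → ℝ) {G : (ι → ℝ) → ℝ} (hG : Measurable G)
    (hG0 : ∀ y, 0 ≤ G y) (hGe : ∀ u y, G (signFlip u y) = G y)
    (hi : Integrable (fun z => signProd A (ouMap a b x z) *
      G (ouMap a b x z)) (gaussianPi ι)) :
    0 ≤ signProd A x * ∫ z, signProd A (ouMap a b x z) *
      G (ouMap a b x z) ∂gaussianPi ι := by
  have hF : Measurable fun y => signProd A y * G y := (measurable_signProd A).mul hG
  have hM := measurable_mehlerPi_right a b x
  rw [← integral_mehlerPi_mul hb hab x (F := fun y => signProd A y * G y) hF]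
  have hi' := integrable_mehlerPi_mul hb hab x hF hi
  set I := ∫ y, mehlerPi a b x y * (signProd A y * G y) ∂gaussianPi ι with hI
  have hrw : ∀ u y, mehlerPi a b x (signFlip u y) *
      (signProd A (signFlip u y) * G (signFlip u y))
      = (walsh A u * mehlerPi a b x (signFlip u y)) * (signProd A y * G y) := by
    intro u y
    rw [signProd_signFlip, hGe]
    ring
  have hu : ∀ u : ι → ℤˣ, I = ∫ y, (walsh A u * mehlerPi a b x (signFlip u y)) *
      (signProd A y * G y) ∂gaussianPi ι := by
    intro u
    refine (integral_comp_measurePreserving (measurePreserving_signFlip u) (hM.mul hF)).symm.trans ?_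
    exact integral_congr_ae (ae_of_all _ fun y => hrw u y)
  have hui : ∀ u : ι → ℤˣ, Integrable (fun y => (walsh A u * mehlerPi a b x (signFlip u y)) *
      (signProd A y * G y)) (gaussianPi ι) := by
    intro u
    have := (measurePreserving_signFlip u).integrable_comp_of_integrable hi'
    exact this.congr (ae_of_all _ fun y => hrw u y)
  have hsum : Fintype.card (ι → ℤˣ) * I = ∫ y, (∑ u : ι → ℤˣ, walsh A u *
      mehlerPi a b x (signFlip u y)) * (signProd A y * G y) ∂gaussianPi ι := by
    simp_rw [Finset.sum_mul]
    rw [integral_finsetSum _ fun u _ => hui u, ← Finset.sum_congr rfl fun u _ => hu u]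
    simp
  have hpos : 0 ≤ signProd A x * (Fintype.card (ι → ℤˣ) * I) := by
    rw [hsum, ← integral_const_mul]
    refine integral_nonneg fun y => ?_
    have := mul_nonneg (signProd_mul_sum_mehlerPi_nonneg ha hb A x y) (hG0 y)
    simp only [Pi.zero_apply]
    linarith
  have hc : (0 : ℝ) < Fintype.card (ι → ℤˣ) := by
    exact_mod_cast Fintype.card_pos
  by_contra! hneg
  nlinarith

end Continuous

section ContinuousDecay

variable {ι : Type*}

lemma measurable_ouMap_prod (a b : ℝ) :
    Measurable fun ω : (ι → ℝ) × (ι → ℝ) => ouMap a b ω.1 ω.2 := by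
  unfold ouMap
  fun_prop

variable [Fintype ι]

lemma lintegral_ouMap {a b : ℝ} (hb : 0 < b) (hab : a ^ 2 + b ^ 2 = 1)
    {F : (ι → ℝ) × (ι → ℝ) → ENNReal} (hF : Measurable F) :
    ∫⁻ ω, F (ω.1, ouMap a b ω.1 ω.2) ∂pairGauss ι
      = ∫⁻ q, ENNReal.ofReal (mehlerPi a b q.1 q.2) * F q ∂pairGauss ι := by
  have h1 : Measurable fun ω : (ι → ℝ) × (ι → ℝ) => F (ω.1, ouMap a b ω.1 ω.2) :=
    hF.comp (measurable_fst.prodMk (measurable_ouMap_prod a b))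
  have h2 : Measurable fun q : (ι → ℝ) × (ι → ℝ) =>
      ENNReal.ofReal (mehlerPi a b q.1 q.2) * F q := (measurable_mehlerPi a b).ennreal_ofReal.mul hF
  rw [pairGauss, lintegral_prod _ h1.aemeasurable, lintegral_prod _ h2.aemeasurable]
  refine lintegral_congr fun x => ?_
  have hFx : Measurable fun y => F (x, y) := hF.comp measurable_prodMk_left
  rw [← lintegral_map (f := fun y => F (x, y)) hFx (measurable_ouMap x),
    ← gaussianPi_withDensity_mehlerPi hb hab,
    lintegral_withDensity_eq_lintegral_mul _ (measurable_mehlerPi_right a b x).ennreal_ofReal hFx]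
  rfl

/-- The pair `(x, a x + b z)` is exchangeable. -/
lemma map_ouMap_swap {a b : ℝ} (hb : 0 < b) (hab : a ^ 2 + b ^ 2 = 1) :
    (pairGauss ι).map (fun ω => (ouMap a b ω.1 ω.2, ω.1))
      = (pairGauss ι).map fun ω => (ω.1, ouMap a b ω.1 ω.2) := by
  have hm := measurable_ouMap_prod (ι := ι) a b
  refine Measure.ext_of_lintegral _ fun F hF => ?_
  rw [lintegral_map hF (hm.prodMk measurable_fst), lintegral_map hF (measurable_fst.prodMk hm),
    lintegral_ouMap hb hab hF]
  refine (lintegral_ouMap hb hab (hF.comp measurable_swap)).trans ?_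
  unfold pairGauss
  rw [← lintegral_prod_swap]
  refine lintegral_congr fun q => ?_
  simp [mehlerPi_comm a b q.2 q.1]

lemma integrable_id_gaussianReal : Integrable (fun x : ℝ => x) (gaussianReal 0 1) :=
  (memLp_id_gaussianReal 1).integrable le_rfl

lemma integral_prod_gaussianPi [DecidableEq ι] (A : Finset ι) (a b : ℝ) (x : ι → ℝ) :
    Integrable (fun z => ∏ e ∈ A, ouMap a b x z e) (gaussianPi ι) ∧
    ∫ z, ∏ e ∈ A, ouMap a b x z e ∂gaussianPi ι = a ^ #A * ∏ e ∈ A, x e := by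
  have hrw : (fun z : ι → ℝ => ∏ e ∈ A, ouMap a b x z e)
      = fun z => ∏ e, if e ∈ A then a * x e + b * z e else 1 := by
    ext z
    rw [Finset.prod_ite_mem, Finset.univ_inter]
    rfl
  have hi : ∀ e, Integrable (fun r : ℝ => if e ∈ A then a * x e + b * r else 1)
      (gaussianReal 0 1) := by
    intro e
    split_ifs
    · exact (integrable_const _).add (integrable_id_gaussianReal.const_mul b)
    · exact integrable_const _
  rw [hrw]
  refine ⟨Integrable.fintype_prod hi, ?_⟩
  unfold gaussianPi
  rw [integral_fintype_prod_eq_prod (fun e (r : ℝ) => if e ∈ A then a * x e + b * r else 1)]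
  have he : ∀ e, ∫ r : ℝ, (if e ∈ A then a * x e + b * r else 1) ∂gaussianReal 0 1
      = if e ∈ A then a * x e else 1 := by
    intro e
    split_ifs
    · rw [integral_add (integrable_const _) (integrable_id_gaussianReal.const_mul b),
        integral_const_mul b (fun r : ℝ => r), integral_id_gaussianReal]
      simp
    · simp
  rw [Finset.prod_congr rfl fun e _ => he e, Finset.prod_ite_mem, Finset.univ_inter,
    Finset.prod_mul_distrib, Finset.prod_const]

lemma integrable_prod_gaussianPi [DecidableEq ι] (A : Finset ι) :
    Integrable (fun x : ι → ℝ => ∏ e ∈ A, x e) (gaussianPi ι) := by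
  simpa [ouMap] using (integral_prod_gaussianPi A 0 1 0).1

lemma mul_le_weighted_sq {p q u v : ℝ} (hp : 0 ≤ p) (hq : 0 ≤ q) (hup : p = 0 → u = 0)
    (hvq : q = 0 → v = 0) : u * v ≤ (u ^ 2 / p * q + v ^ 2 / q * p) / 2 := by
  rcases hp.eq_or_lt' with rfl | hp
  · simp [hup rfl]
  rcases hq.eq_or_lt' with rfl | hq
  · simp [hvq rfl]
  have h : (u ^ 2 / p * q + v ^ 2 / q * p) / 2 - u * v = (u * q - v * p) ^ 2 / (2 * p * q) := by
    field_simp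
    ring
  have : 0 ≤ (u * q - v * p) ^ 2 / (2 * p * q) := by positivity
  linarith

lemma integral_ouMap_mul_le_of_sep [DecidableEq ι] {a b : ℝ} (ha : 0 ≤ a) (hb : 0 < b)
    (hab : a ^ 2 + b ^ 2 = 1) (A : Finset ι) {f : (ι → ℝ) → ℝ} (hf : Measurable f)
    (hf1 : ∀ x, |f x| ≤ 1) (hodd : ∀ u x, f (signFlip u x) = walsh A u * f x)
    {ε : ℝ} (hε : 0 < ε) (hsep : ∀ x, f x ≠ 0 → ∀ e ∈ A, ε ≤ |x e|) :
    ∫ ω, f ω.1 * f (ouMap a b ω.1 ω.2) ∂pairGauss ι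
      ≤ a ^ #A * ∫ x, f x * f x ∂gaussianPi ι := by
  set S := ∫ x, f x * f x ∂gaussianPi ι with hS
  set h : (ι → ℝ) → ℝ := fun x => ∏ e ∈ A, |x e| with hh
  set g : (ι → ℝ) → ℝ := fun y => signProd A y * (f y ^ 2 / h y) with hg
  have hsm := measurable_signProd A
  have hhm : Measurable h := by fun_prop
  have hgm : Measurable g := hsm.mul ((hf.pow_const 2).div hhm)
  have hh0 : ∀ x, 0 ≤ h x := fun x => Finset.prod_nonneg fun _ _ => abs_nonneg _
  have hhf : ∀ x, f x ≠ 0 → ε ^ #A ≤ h x := by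
    intro x hx
    rw [← Finset.prod_const]
    exact Finset.prod_le_prod (fun _ _ => hε.le) (hsep x hx)
  have hf0 : ∀ x, h x = 0 → f x = 0 := by
    intro x hx
    by_contra hne
    have := hhf x hne
    have : 0 < ε ^ #A := by positivity
    linarith
  have hs1 : ∀ x, f x ≠ 0 → signProd A x * signProd A x = 1 := by
    intro x hx
    refine signProd_mul_self fun e he h0 => ?_
    have := hsep x hx e he
    rw [h0, abs_zero] at this
    linarith
  have hssf : ∀ x, signProd A x * signProd A x * f x = f x := by
    intro x
    by_cases hx : f x = 0
    · simp [hx]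
    · rw [hs1 x hx, one_mul]
  have hssq : ∀ x, (signProd A x * f x) ^ 2 = f x ^ 2 := by
    intro x
    linear_combination f x * hssf x
  have hgP : ∀ x, g x * ∏ e ∈ A, x e = f x ^ 2 := by
    intro x
    rw [← signProd_mul_prod_abs A x]
    by_cases hx : f x = 0
    · simp [hg, hx]
    · have h1 : h x ≠ 0 := fun h1 => hx (hf0 x h1)
      have h2 : f x ^ 2 / h x * h x = f x ^ 2 := div_mul_cancel₀ _ h1
      simp only [hg]
      linear_combination (f x ^ 2 / h x * h x) * hs1 x hx + h2
  have hgb : ∀ y, |g y| ≤ (ε ^ #A)⁻¹ := by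
    intro y
    by_cases hy : f y = 0
    · simp only [hg, hy]
      simp only [ne_eq, OfNat.ofNat_ne_zero, not_false_eq_true, zero_pow, zero_div, mul_zero,
        abs_zero]
      positivity
    · have hεA : 0 < ε ^ #A := by positivity
      have h1 : 0 < h y := hεA.trans_le (hhf y hy)
      rw [hg, abs_mul, abs_div, abs_of_pos h1, abs_pow]
      calc |signProd A y| * (|f y| ^ 2 / h y) ≤ 1 * (1 / h y) := by
            refine mul_le_mul (abs_signProd_le A y) ?_ (by positivity) zero_le_one
            gcongr
            exact pow_le_one₀ (abs_nonneg _) (hf1 y)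
        _ = (h y)⁻¹ := by simp
        _ ≤ (ε ^ #A)⁻¹ := by
            gcongr
            exact hhf y hy
  have hgi : ∀ x, Integrable (fun z => g (ouMap a b x z)) (gaussianPi ι) := fun x =>
    Integrable.of_bound (hgm.comp (measurable_ouMap x)).aestronglyMeasurable _
      (ae_of_all _ fun z => hgb _)
  have hfi : ∀ x, Integrable (fun z => f (ouMap a b x z)) (gaussianPi ι) := fun x =>
    integrable_of_abs_le_one (hf.comp (measurable_ouMap x)) fun z => hf1 _
  have hP := fun x : ι → ℝ => integral_prod_gaussianPi A a b x
  have hpt : ∀ x, f x * ∫ z, f (ouMap a b x z) ∂gaussianPi ι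
      ≤ (a ^ #A * f x ^ 2 + (∏ e ∈ A, x e) * ∫ z, g (ouMap a b x z) ∂gaussianPi ι) / 2 := by
    intro x
    set G : (ι → ℝ) → ℝ := fun y => (f x ^ 2 / h x * h y + f y ^ 2 / h y * h x) / 2
      - (signProd A x * f x) * (signProd A y * f y) with hG
    have hsG : ∀ y, signProd A y * G y = f x ^ 2 / h x / 2 * (∏ e ∈ A, y e) + h x / 2 * g y
        - signProd A x * f x * f y := by
      intro y
      rw [← signProd_mul_prod_abs A y]
      simp only [hG, hg, hh]
      linear_combination (-signProd A x * f x) * hssf y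
    have hkey := signProd_mul_integral_nonneg ha hb hab A x (G := G) ?_ ?_ ?_ ?_
    · simp_rw [hsG] at hkey
      rw [integral_sub, integral_add, integral_const_mul, integral_const_mul, integral_const_mul,
        (hP x).2] at hkey
      · have h1 : signProd A x * h x = ∏ e ∈ A, x e := signProd_mul_prod_abs A x
        have h2 : signProd A x * (f x ^ 2 / h x) * ∏ e ∈ A, x e = f x ^ 2 := hgP x
        rw [← sub_nonneg]
        refine hkey.trans_eq ?_
        linear_combination (a ^ #A / 2) * h2
          + (1 / 2 * ∫ z, g (ouMap a b x z) ∂gaussianPi ι) * h1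
          - (∫ z, f (ouMap a b x z) ∂gaussianPi ι) * hssf x
      · exact (hP x).1.const_mul _
      · exact (hgi x).const_mul _
      · exact ((hP x).1.const_mul _).add ((hgi x).const_mul _)
      · exact (hfi x).const_mul _
    · fun_prop
    · intro y
      have := mul_le_weighted_sq (u := signProd A x * f x) (v := signProd A y * f y) (hh0 x) (hh0 y)
        (fun h0 => by rw [hf0 x h0, mul_zero]) (fun h0 => by rw [hf0 y h0, mul_zero])
      rw [hssq, hssq] at this
      exact sub_nonneg.2 this
    · intro u y
      have h1 : h (signFlip u y) = h y :=
        Finset.prod_congr rfl fun e _ => by rw [signFlip, abs_mul, abs_unit_cast, one_mul]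
      have h2 : signProd A (signFlip u y) * f (signFlip u y) = signProd A y * f y := by
        rw [signProd_signFlip, hodd]
        linear_combination (signProd A y * f y) * walsh_mul_self A u
      have h3 : f (signFlip u y) ^ 2 = f y ^ 2 := by rw [← hssq, h2, hssq]
      simp only [hG, h1, h2, h3]
    · simp_rw [hsG]
      exact (((hP x).1.const_mul _).add ((hgi x).const_mul _)).sub ((hfi x).const_mul _)
  have hm := measurable_ouMap_prod (ι := ι) a b
  have hPi := integrable_prod_gaussianPi A
  have hPm : Measurable fun x : ι → ℝ => ∏ e ∈ A, x e := by fun_prop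
  have hff : Integrable (fun ω : (ι → ℝ) × (ι → ℝ) => f ω.1 * f (ouMap a b ω.1 ω.2))
      (pairGauss ι) := by
    unfold pairGauss
    exact integrable_of_abs_le_one ((hf.comp measurable_fst).mul (hf.comp hm))
      fun _ => abs_mul_le_one (hf1 _) (hf1 _)
  have hPg : Integrable (fun ω : (ι → ℝ) × (ι → ℝ) => (∏ e ∈ A, ω.1 e) * g (ouMap a b ω.1 ω.2))
      (pairGauss ι) :=
    (hPi.comp_fst (gaussianPi ι)).mul_bdd (hgm.comp hm).aestronglyMeasurable
      (ae_of_all _ fun ω => hgb _)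
  have hexch : ∫ ω, (∏ e ∈ A, ω.1 e) * g (ouMap a b ω.1 ω.2) ∂pairGauss ι = a ^ #A * S := by
    have hFm : Measurable fun q : (ι → ℝ) × (ι → ℝ) => (∏ e ∈ A, q.1 e) * g q.2 :=
      (hPm.comp measurable_fst).mul (hgm.comp measurable_snd)
    have h1 := integral_map (μ := pairGauss ι) (measurable_fst.prodMk hm).aemeasurable
      hFm.aestronglyMeasurable
    have h2 := integral_map (μ := pairGauss ι) (hm.prodMk measurable_fst).aemeasurable
      hFm.aestronglyMeasurable
    have hPg' : Integrable (fun ω : (ι → ℝ) × (ι → ℝ) => (∏ e ∈ A, ouMap a b ω.1 ω.2 e) * g ω.1)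
        (pairGauss ι) := by
      have h3 := (integrable_map_measure (μ := pairGauss ι) hFm.aestronglyMeasurable
        (measurable_fst.prodMk hm).aemeasurable).2 hPg
      rw [← map_ouMap_swap hb hab] at h3
      exact (integrable_map_measure (μ := pairGauss ι) hFm.aestronglyMeasurable
        (hm.prodMk measurable_fst).aemeasurable).1 h3
    rw [map_ouMap_swap hb hab] at h2
    refine h1.symm.trans (h2.trans ?_)
    unfold pairGauss at hPg' ⊢
    rw [integral_prod _ hPg', hS, ← integral_const_mul]
    refine integral_congr_ae (ae_of_all _ fun x => ?_)
    simp only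
    rw [integral_mul_const, (hP x).2]
    linear_combination a ^ #A * hgP x
  have hffx := hff.integral_prod_left
  have hPgx := hPg.integral_prod_left
  have hfsi : Integrable (fun x => f x * f x) (gaussianPi ι) :=
    integrable_of_abs_le_one (hf.mul hf) fun _ => abs_mul_le_one (hf1 _) (hf1 _)
  calc ∫ ω, f ω.1 * f (ouMap a b ω.1 ω.2) ∂pairGauss ι
      = ∫ x, ∫ z, f x * f (ouMap a b x z) ∂gaussianPi ι ∂gaussianPi ι := integral_prod _ hff
    _ ≤ ∫ x, (a ^ #A * (f x * f x) +
          ∫ z, (∏ e ∈ A, x e) * g (ouMap a b x z) ∂gaussianPi ι) / 2 ∂gaussianPi ι := by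
        refine integral_mono hffx (((hfsi.const_mul _).add hPgx).div_const 2) fun x => ?_
        simp only
        rw [integral_const_mul, integral_const_mul, ← sq]
        exact hpt x
    _ = (a ^ #A * S + ∫ ω, (∏ e ∈ A, ω.1 e) * g (ouMap a b ω.1 ω.2) ∂pairGauss ι) / 2 := by
        rw [integral_div, integral_add (hfsi.const_mul _) hPgx, integral_const_mul]
        congr 2
        exact (integral_prod _ hPg).symm
    _ = a ^ #A * S := by
        rw [hexch]
        ring

lemma integral_ouMap_mul_le [DecidableEq ι] {a b : ℝ} (ha : 0 ≤ a) (hb : 0 < b)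
    (hab : a ^ 2 + b ^ 2 = 1) (A : Finset ι) {f : (ι → ℝ) → ℝ} (hf : Measurable f)
    (hf1 : ∀ x, |f x| ≤ 1) (hodd : ∀ u x, f (signFlip u x) = walsh A u * f x) :
    ∫ ω, f ω.1 * f (ouMap a b ω.1 ω.2) ∂pairGauss ι
      ≤ a ^ #A * ∫ x, f x * f x ∂gaussianPi ι := by
  have : IsProbabilityMeasure (pairGauss ι) := by unfold pairGauss; infer_instance
  set E : ℕ → Set (ι → ℝ) := fun n => {x | ∀ e ∈ A, 1 / ((n : ℝ) + 1) ≤ |x e|} with hE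
  have hEm : ∀ n, MeasurableSet (E n) := by
    intro n
    simp only [hE, Set.ofPred_forall]
    exact MeasurableSet.biInter A.countable_toSet fun e _ =>
      measurableSet_le measurable_const (by fun_prop)
  set F : ℕ → (ι → ℝ) → ℝ := fun n => (E n).indicator f with hF
  have hFm : ∀ n, Measurable (F n) := fun n => hf.indicator (hEm n)
  have hF1 : ∀ n x, |F n x| ≤ 1 := by
    intro n x
    by_cases hx : x ∈ E n
    · simp only [hF, Set.indicator_of_mem hx, hf1]
    · simp [hF, Set.indicator_of_notMem hx]
  have hlim : ∀ x, Filter.Tendsto (fun n => F n x) Filter.atTop (nhds (f x)) := by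
    intro x
    by_cases hx : ∃ e ∈ A, x e = 0
    · obtain ⟨e, he, hxe⟩ := hx
      have hfx : f x = 0 := by
        set u : ι → ℤˣ := Function.update 1 e (-1) with hu
        have h1 : signFlip u x = x := by
          ext e'
          by_cases h : e' = e
          · subst h
            simp [signFlip, hxe]
          · simp [signFlip, hu, h]
        have h2 : walsh A u = -1 := by
          rw [walsh, Finset.prod_eq_single_of_mem e he]
          · simp [hu]
          · intro e' _ h
            simp [hu, h]
        have h3 := hodd u x
        rw [h1, h2] at h3
        linarith
      have : ∀ n, F n x = 0 := fun n => by
        simp only [hF, Set.indicator_apply, hfx, ite_self]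
      simp [this, hfx]
    · push Not at hx
      have hev : ∀ e ∈ A, ∀ᶠ n : ℕ in Filter.atTop, 1 / ((n : ℝ) + 1) ≤ |x e| := fun e he =>
        tendsto_one_div_add_atTop_nhds_zero_nat.eventually_le_const (abs_pos.2 (hx e he))
      have hall : ∀ᶠ n : ℕ in Filter.atTop, ∀ e ∈ A, 1 / ((n : ℝ) + 1) ≤ |x e| :=
        (Filter.eventually_all_finset A).2 hev
      refine tendsto_const_nhds.congr' ?_
      filter_upwards [hall] with n hn
      exact (Set.indicator_of_mem (by exact hn) f).symm
  have hFodd : ∀ n u x, F n (signFlip u x) = walsh A u * F n x := by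
    intro n u x
    have h : signFlip u x ∈ E n ↔ x ∈ E n := by
      simp [hE, signFlip, abs_mul, abs_unit_cast]
    by_cases hx : x ∈ E n
    · simp only [hF, Set.indicator_of_mem hx, Set.indicator_of_mem (h.2 hx), hodd]
    · simp only [hF, Set.indicator_of_notMem hx, Set.indicator_of_notMem (fun h' => hx (h.1 h')),
        mul_zero]
  have hsep : ∀ n x, F n x ≠ 0 → ∀ e ∈ A, 1 / ((n : ℝ) + 1) ≤ |x e| := by
    intro n x hx
    exact Set.mem_of_indicator_ne_zero hx
  have hm := measurable_ouMap_prod (ι := ι) a b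
  refine le_of_tendsto_of_tendsto' (f := fun n => ∫ ω, F n ω.1 * F n (ouMap a b ω.1 ω.2)
    ∂pairGauss ι) (g := fun n => a ^ #A * ∫ x, F n x * F n x ∂gaussianPi ι) (b := Filter.atTop)
    ?_ (Filter.Tendsto.const_mul _ ?_) fun n =>
      integral_ouMap_mul_le_of_sep ha hb hab A (hFm n) (hF1 n) (hFodd n) (by positivity) (hsep n)
  · refine tendsto_integral_of_dominated_convergence (fun _ => 1)
      (fun n => (((hFm n).comp measurable_fst).mul ((hFm n).comp hm)).aestronglyMeasurable)
      (integrable_const _) (fun n => ae_of_all _ fun ω => abs_mul_le_one (hF1 _ _) (hF1 _ _))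
      (ae_of_all _ fun ω => (hlim _).mul (hlim _))
  · refine tendsto_integral_of_dominated_convergence (fun _ => 1)
      (fun n => ((hFm n).mul (hFm n)).aestronglyMeasurable)
      (integrable_const _) (fun n => ae_of_all _ fun ω => abs_mul_le_one (hF1 _ _) (hF1 _ _))
      (ae_of_all _ fun ω => (hlim _).mul (hlim _))

/-- A function without Walsh components of order below `m` has correlation at most `e^{-tm}` under
the continuous perturbation at time `t`. -/
lemma integral_contPerturb_le_pow [DecidableEq ι] {t : ℝ} (ht : 0 ≤ t)
    {φ : (ι → ℝ) → ℝ} (hφ : Measurable φ) (hφ1 : ∀ x, |φ x| ≤ 1) {m : ℕ}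
    (hm : ∀ A : Finset ι, #A < m → ∀ x, walshComp A φ x = 0) :
    ∫ ω, φ ω.1 * φ (contPerturb t ω.1 ω.2) ∂pairGauss ι ≤ exp (-t) ^ m := by
  have : IsProbabilityMeasure (pairGauss ι) := by unfold pairGauss; infer_instance
  have hou : ∀ x z : ι → ℝ, contPerturb t x z = ouMap (exp (-t)) (√(1 - exp (-2 * t))) x z :=
    fun _ _ => rfl
  simp_rw [hou]
  refine integral_mul_le_pow measurable_fst (measurable_ouMap_prod _ _) (exp_pos _).le
    (exp_le_one_iff.2 (by linarith)) (fun s => ?_) (fun A f hf hf1 hodd => ?_) hφ hφ1 hm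
  · refine ⟨Prod.map (signFlip s) (signFlip s),
      (measurePreserving_signFlip s).prod (measurePreserving_signFlip s), fun ω => ⟨rfl, ?_⟩⟩
    ext e
    simp only [ouMap, signFlip, Prod.map_fst, Prod.map_snd]
    ring
  · rcases ht.eq_or_lt with rfl | ht
    · have h : ∀ x z : ι → ℝ, ouMap (exp (-0)) (√(1 - exp (-2 * 0))) x z = x := by
        intro x z
        ext e
        simp [ouMap]
      simp_rw [h]
      rw [neg_zero, exp_zero, one_pow, one_mul]
      unfold pairGauss
      exact (integral_comp_measurePreserving measurePreserving_fst (hf.mul hf)).le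
    · have he : exp (-2 * t) < 1 := exp_lt_one_iff.2 (by linarith)
      refine integral_ouMap_mul_le (exp_pos _).le (sqrt_pos.2 (by linarith)) ?_ A hf hf1 hodd
      rw [sq_sqrt (by linarith), ← exp_nat_mul]
      push_cast
      ring_nf

end ContinuousDecay

/-! ### Two-point functions and their Walsh support -/

lemma abs_spin (b : Bool) : |spin b| = 1 := by
  cases b <;> simp [spin]

lemma spin_not (b : Bool) : spin (!b) = -spin b := by
  cases b <;> simp [spin]

/-- The two-point function `⟨σ_i σ_j⟩` as a function of the disorder. -/
def twoPoint (G : Finset (Finset (Fin N))) (ρ : ℕ → ℝ → ℝ) (β : ℝ) (i j : Fin N)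
    (J : Finset (Fin N) → ℝ) : ℝ :=
  gibbs β (ham G ρ J) fun σ => spin (σ i) * spin (σ j)

lemma partition_pos (β : ℝ) (H : (Fin N → Bool) → ℝ) :
    0 < ∑ σ : Fin N → Bool, exp (β * H σ) :=
  Finset.sum_pos (fun _ _ => exp_pos _) Finset.univ_nonempty

lemma abs_twoPoint_le (G : Finset (Finset (Fin N))) (ρ : ℕ → ℝ → ℝ) (β : ℝ) (i j : Fin N)
    (J : Finset (Fin N) → ℝ) : |twoPoint G ρ β i j J| ≤ 1 := by
  rw [twoPoint, gibbs, abs_div, abs_of_pos (partition_pos _ _), div_le_one (partition_pos _ _)]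
  refine (Finset.abs_sum_le_sum_abs _ _).trans (Finset.sum_le_sum fun σ _ => ?_)
  rw [abs_mul, abs_mul, abs_spin, abs_spin, abs_of_pos (exp_pos _), one_mul, one_mul]

lemma measurable_ham (G : Finset (Finset (Fin N))) {ρ : ℕ → ℝ → ℝ} (hρ : ∀ p, Measurable (ρ p))
    (σ : Fin N → Bool) : Measurable fun J => ham G ρ J σ := by
  unfold ham
  exact Finset.measurable_fun_sum _ fun e _ =>
    ((hρ _).comp (measurable_pi_apply e)).mul_const _

lemma measurable_twoPoint (G : Finset (Finset (Fin N))) {ρ : ℕ → ℝ → ℝ}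
    (hρ : ∀ p, Measurable (ρ p)) (β : ℝ) (i j : Fin N) : Measurable (twoPoint G ρ β i j) := by
  have h := fun σ => measurable_ham G hρ σ
  unfold twoPoint gibbs
  fun_prop

lemma gibbs2_overlap_sq (β : ℝ) (G : Finset (Finset (Fin N))) (ρ : ℕ → ℝ → ℝ)
    (J J' : Finset (Fin N) → ℝ) :
    gibbs2 β (ham G ρ J) (ham G ρ J') (fun σ τ => overlap σ τ ^ 2)
      = (∑ i, ∑ j, twoPoint G ρ β i j J * twoPoint G ρ β i j J') / (N : ℝ) ^ 2 := by
  have hov : ∀ σ τ : Fin N → Bool, overlap σ τ ^ 2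
      = (∑ i, ∑ j, (spin (σ i) * spin (σ j)) * (spin (τ i) * spin (τ j))) / (N : ℝ) ^ 2 := by
    intro σ τ
    rw [overlap, div_pow, sq (∑ i, _), Finset.sum_mul_sum]
    congr 1
    exact Finset.sum_congr rfl fun i _ => Finset.sum_congr rfl fun j _ => by ring
  have hZ : ∑ σ : Fin N → Bool, ∑ τ : Fin N → Bool, exp (β * ham G ρ J σ + β * ham G ρ J' τ)
      = (∑ σ : Fin N → Bool, exp (β * ham G ρ J σ)) *
        ∑ τ : Fin N → Bool, exp (β * ham G ρ J' τ) := by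
    rw [Finset.sum_mul_sum]
    simp only [exp_add]
  have hnum : ∀ i j, (∑ σ : Fin N → Bool, (spin (σ i) * spin (σ j)) * exp (β * ham G ρ J σ)) *
      (∑ τ : Fin N → Bool, (spin (τ i) * spin (τ j)) * exp (β * ham G ρ J' τ))
      = ∑ σ : Fin N → Bool, ∑ τ : Fin N → Bool,
        (spin (σ i) * spin (σ j)) * (spin (τ i) * spin (τ j)) *
          exp (β * ham G ρ J σ + β * ham G ρ J' τ) := by
    intro i j
    rw [Finset.sum_mul_sum]
    refine Finset.sum_congr rfl fun σ _ => Finset.sum_congr rfl fun τ _ => ?_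
    rw [exp_add]
    ring
  unfold gibbs2 twoPoint gibbs
  simp_rw [div_mul_div_comm, hnum, ← Finset.sum_div, hZ, hov]
  rw [div_right_comm]
  congr 1
  simp_rw [div_mul_eq_mul_div, ← Finset.sum_div, Finset.sum_mul]
  congr 1
  calc _ = ∑ σ : Fin N → Bool, ∑ i, ∑ τ : Fin N → Bool, ∑ j, _ :=
        Finset.sum_congr rfl fun σ _ => Finset.sum_comm
    _ = ∑ i, ∑ σ : Fin N → Bool, ∑ τ : Fin N → Bool, ∑ j, _ := Finset.sum_comm
    _ = ∑ i, ∑ σ : Fin N → Bool, ∑ j, ∑ τ : Fin N → Bool, _ :=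
        Finset.sum_congr rfl fun i _ => Finset.sum_congr rfl fun σ _ => Finset.sum_comm
    _ = _ := Finset.sum_congr rfl fun i _ => Finset.sum_comm

/-- The sign flip of all couplings of edges containing `v`. -/
def vertexFlip (v : Fin N) : Finset (Fin N) → ℤˣ := fun e => if v ∈ e then -1 else 1

/-- Flipping the spin at `v`. -/
def spinFlip (v : Fin N) : (Fin N → Bool) ≃ (Fin N → Bool) :=
  Function.Involutive.toPerm (fun σ => Function.update σ v (!σ v)) fun σ => by simp

lemma spinFlip_apply (v : Fin N) (σ : Fin N → Bool) :
    spinFlip v σ = Function.update σ v (!σ v) := rfl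

lemma spin_spinFlip (v i : Fin N) (σ : Fin N → Bool) :
    spin (spinFlip v σ i) = (if v = i then -1 else 1) * spin (σ i) := by
  by_cases h : v = i
  · subst h
    simp [spinFlip_apply, spin_not]
  · simp [spinFlip_apply, h, Function.update_of_ne (Ne.symm h)]

lemma sigEdge_spinFlip (v : Fin N) (e : Finset (Fin N)) (σ : Fin N → Bool) :
    sigEdge (spinFlip v σ) e = ((vertexFlip v e : ℤ) : ℝ) * sigEdge σ e := by
  unfold sigEdge
  simp_rw [spin_spinFlip]
  rw [Finset.prod_mul_distrib, Finset.prod_ite_eq]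
  by_cases h : v ∈ e <;> simp [vertexFlip, h]

lemma odd_unit_mul {f : ℝ → ℝ} (hf : ∀ x, f (-x) = -f x) (u : ℤˣ) (x : ℝ) :
    f (((u : ℤ) : ℝ) * x) = ((u : ℤ) : ℝ) * f x := by
  rcases Int.units_eq_one_or u with h | h <;> simp [h, hf]

lemma twoPoint_vertexFlip (G : Finset (Finset (Fin N))) {ρ : ℕ → ℝ → ℝ}
    (hodd : ∀ p x, ρ p (-x) = -ρ p x) (β : ℝ) (i j v : Fin N) (J : Finset (Fin N) → ℝ) :
    twoPoint G ρ β i j (signFlip (vertexFlip v) J)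
      = ((if v = i then -1 else 1) * (if v = j then -1 else 1)) * twoPoint G ρ β i j J := by
  have hham : ∀ σ, ham G ρ (signFlip (vertexFlip v) J) (spinFlip v σ) = ham G ρ J σ := by
    intro σ
    refine Finset.sum_congr rfl fun e _ => ?_
    rw [signFlip, odd_unit_mul (hodd _), sigEdge_spinFlip, mul_mul_mul_comm, unit_cast_mul_self,
      one_mul]
  unfold twoPoint gibbs
  rw [← mul_div_assoc, Finset.mul_sum]
  congr 1
  · refine (Fintype.sum_equiv (spinFlip v) _ _ fun σ => ?_).symm
    simp only [hham, spin_spinFlip]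
    ring
  · refine (Fintype.sum_equiv (spinFlip v) _ _ fun σ => ?_).symm
    rw [hham]

lemma walsh_vertexFlip (A : Finset (Finset (Fin N))) (v : Fin N) :
    walsh A (vertexFlip v) = (-1) ^ #{e ∈ A | v ∈ e} := by
  unfold walsh vertexFlip
  rw [← Finset.prod_const, Finset.prod_filter]
  exact Finset.prod_congr rfl fun e _ => by split_ifs <;> simp

/-- A nonzero Walsh component of `⟨σ_i σ_j⟩` is supported on edges of the hypergraph, and exactly
the vertices `i` and `j` have odd degree in its support. -/
lemma odd_degree_of_walshComp_twoPoint_ne_zero {G : Finset (Finset (Fin N))} {ρ : ℕ → ℝ → ℝ}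
    (hodd : ∀ p x, ρ p (-x) = -ρ p x) {β : ℝ} {i j : Fin N} (hij : i ≠ j)
    {A : Finset (Finset (Fin N))} {J : Finset (Fin N) → ℝ}
    (hne : walshComp A (twoPoint G ρ β i j) J ≠ 0) :
    A ⊆ G ∧ ∀ v, Odd #{e ∈ A | v ∈ e} ↔ v = i ∨ v = j := by
  constructor
  · intro e he
    by_contra heG
    refine hne (walshComp_eq_zero (u := Function.update 1 e (-1)) (c := 1) (fun x => ?_) ?_ J)
    · have hham : ham G ρ (signFlip (Function.update 1 e (-1)) x) = ham G ρ x := by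
        ext σ
        refine Finset.sum_congr rfl fun e' he' => ?_
        have : e' ≠ e := fun h => heG (h ▸ he')
        simp [signFlip, this]
      rw [twoPoint, hham, one_mul, twoPoint]
    · rw [walsh, Finset.prod_eq_single_of_mem e he]
      · norm_num
      · intro e' _ h
        simp [h]
  · intro v
    have h := not_imp_comm.1 (fun hc => walshComp_eq_zero (A := A)
      (twoPoint_vertexFlip G hodd β i j v) hc J) hne
    rw [walsh_vertexFlip] at h
    rcases Nat.even_or_odd #{e ∈ A | v ∈ e} with he | ho
    · rw [he.neg_one_pow] at h
      refine iff_of_false (Nat.not_odd_iff_even.2 he) ?_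
      rintro (rfl | rfl)
      · norm_num [hij] at h
      · norm_num [hij.symm] at h
    · rw [ho.neg_one_pow] at h
      refine iff_of_true ho ?_
      by_contra hv
      push Not at hv
      norm_num [hv.1, hv.2] at h

/-! ### Walks and lassos in a hypergraph -/

/-- `IsTrail G D k u w`: there is a walk of length `k` from `u` to `w` along distinct edges of `G`
that are not in `D`. -/
def IsTrail (G : Finset (Finset (Fin N))) :
    Finset (Finset (Fin N)) → ℕ → Fin N → Fin N → Prop
  | _, 0, u, w => u = w
  | D, k + 1, u, w => ∃ e ∉ D, ∃ v ≠ u, u ∈ e ∧ v ∈ e ∧ e ∈ G ∧ IsTrail G (insert e D) k v w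

/-- `IsLasso G D a k u`: there is a walk from `u` along distinct edges of `G` that are not in `D`
which, after `a` steps, crosses an edge to which it comes back `k` steps later. -/
def IsLasso (G : Finset (Finset (Fin N))) :
    Finset (Finset (Fin N)) → ℕ → ℕ → Fin N → Prop
  | D, 0, k, u => ∃ e ∉ D, ∃ v ≠ u, u ∈ e ∧ v ∈ e ∧ e ∈ G ∧ ∃ w ∈ e, IsTrail G (insert e D) k v w
  | D, a + 1, k, u => ∃ e ∉ D, ∃ v ≠ u, u ∈ e ∧ v ∈ e ∧ e ∈ G ∧ IsLasso G (insert e D) a k v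

lemma exists_isTrail_or_isLasso_aux {G F : Finset (Finset (Fin N))} (hFG : F ⊆ G)
    (hG : ∀ e ∈ G, 2 ≤ #e) {i j : Fin N}
    (hpar : ∀ v, Odd #{e ∈ F | v ∈ e} ↔ v = i ∨ v = j) (n : ℕ) :
    ∀ (D : Finset (Finset (Fin N))) (u : Fin N), #(F \ D) = n → (∃ e ∈ F \ D, u ∈ e) →
      (u = i ∨ ∃ e ∈ D, i ∈ e) →
      (∃ k, 1 ≤ k ∧ k ≤ n ∧ IsTrail G D k u j) ∨
      (∃ k, 1 ≤ k ∧ k ≤ n ∧ ∃ w, (∃ e ∈ D, w ∈ e) ∧ IsTrail G D k u w) ∨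
      ∃ a k, 1 ≤ k ∧ a + 1 + k ≤ n ∧ IsLasso G D a k u := by
  induction n with
  | zero =>
    rintro D u hn ⟨e, he, -⟩ -
    rw [Finset.card_eq_zero] at hn
    simp [hn] at he
  | succ n ih =>
    rintro D u hn ⟨e, he, hue⟩ hi
    obtain ⟨heF, heD⟩ := Finset.mem_sdiff.1 he
    have heG := hFG heF
    obtain ⟨v, hve, hvu⟩ := Finset.exists_mem_ne (hG e heG) u
    have hone : ∀ w, v = w → IsTrail G D 1 u w := fun w h =>
      ⟨e, heD, v, hvu, hue, hve, heG, h⟩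
    by_cases hvj : v = j
    · exact Or.inl ⟨1, le_rfl, by lia, hone j hvj⟩
    by_cases hvD : ∃ e ∈ D, v ∈ e
    · exact Or.inr (Or.inl ⟨1, le_rfl, by lia, v, hvD, hone v rfl⟩)
    have hvi : v ≠ i := by
      rintro rfl
      rcases hi with h | h
      · exact hvu h.symm
      · exact hvD h
    have heven : Even #{e ∈ F | v ∈ e} := by
      rw [← Nat.not_odd_iff_even, hpar]
      tauto
    have hmem : e ∈ ({e ∈ F | v ∈ e} : Finset _) := Finset.mem_filter.2 ⟨heF, hve⟩
    have hcard : 2 ≤ #{e ∈ F | v ∈ e} := by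
      have : 0 < #{e ∈ F | v ∈ e} := Finset.card_pos.2 ⟨e, hmem⟩
      obtain ⟨r, hr⟩ := heven
      lia
    obtain ⟨e', he', hne⟩ := Finset.exists_mem_ne hcard e
    obtain ⟨he'F, hve'⟩ := Finset.mem_filter.1 he'
    have hn' : #(F \ insert e D) = n := by
      rw [Finset.sdiff_insert, Finset.card_erase_of_mem he, hn]
      rfl
    have hex : ∃ e' ∈ F \ insert e D, v ∈ e' := by
      refine ⟨e', Finset.mem_sdiff.2 ⟨he'F, fun h => ?_⟩, hve'⟩
      rcases Finset.mem_insert.1 h with h | h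
      · exact hne h
      · exact hvD ⟨e', h, hve'⟩
    have hi' : v = i ∨ ∃ e' ∈ insert e D, i ∈ e' := by
      refine Or.inr ?_
      rcases hi with h | ⟨e', he', hie'⟩
      · exact ⟨e, Finset.mem_insert_self _ _, h ▸ hue⟩
      · exact ⟨e', Finset.mem_insert_of_mem he', hie'⟩
    rcases ih (insert e D) v hn' hex hi' with
      ⟨k, hk1, hkn, hT⟩ | ⟨k, hk1, hkn, w, ⟨e₁, he₁, hwe₁⟩, hT⟩ | ⟨a, k, hk1, hkn, hL⟩
    · exact Or.inl ⟨k + 1, by lia, by lia, e, heD, v, hvu, hue, hve, heG, hT⟩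
    · rcases Finset.mem_insert.1 he₁ with rfl | he₁
      · exact Or.inr (Or.inr ⟨0, k, hk1, by lia, e₁, heD, v, hvu, hue, hve, heG, w, hwe₁, hT⟩)
      · exact Or.inr (Or.inl ⟨k + 1, by lia, by lia, w, ⟨e₁, he₁, hwe₁⟩,
          e, heD, v, hvu, hue, hve, heG, hT⟩)
    · exact Or.inr (Or.inr ⟨a + 1, k, hk1, by lia, e, heD, v, hvu, hue, hve, heG, hL⟩)

/-- The hypergraph `G` contains a trail of length at most `r` from `i` to `j`, or a lasso of length
at most `r` started at `i`. -/
def IsClose (G : Finset (Finset (Fin N))) (r : ℕ) (i j : Fin N) : Prop :=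
  (∃ k ∈ Finset.Icc 1 r, IsTrail G ∅ k i j) ∨
    ∃ p ∈ Finset.range r ×ˢ Finset.Icc 1 r, p.1 + 1 + p.2 ≤ r ∧ IsLasso G ∅ p.1 p.2 i

lemma isClose_of_odd_degree {G F : Finset (Finset (Fin N))} (hFG : F ⊆ G)
    (hG : ∀ e ∈ G, 2 ≤ #e) {i j : Fin N} {r : ℕ} (hr : #F ≤ r)
    (hpar : ∀ v, Odd #{e ∈ F | v ∈ e} ↔ v = i ∨ v = j) : IsClose G r i j := by
  have hex : ∃ e ∈ F \ ∅, i ∈ e := by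
    have h : 0 < #{e ∈ F | i ∈ e} := ((hpar i).2 (Or.inl rfl)).pos
    obtain ⟨e, he⟩ := Finset.card_pos.1 h
    rw [Finset.mem_filter] at he
    exact ⟨e, by simpa using he.1, he.2⟩
  rcases exists_isTrail_or_isLasso_aux hFG hG hpar _ ∅ i rfl hex (Or.inl rfl) with
    ⟨k, hk1, hkn, hT⟩ | ⟨k, hk1, hkn, w, ⟨e, he, -⟩, hT⟩ | ⟨a, k, hk1, hkn, hL⟩
  · rw [Finset.sdiff_empty] at hkn
    exact Or.inl ⟨k, Finset.mem_Icc.2 ⟨hk1, by lia⟩, hT⟩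
  · simp at he
  · rw [Finset.sdiff_empty] at hkn
    refine Or.inr ⟨(a, k), Finset.mem_product.2
      ⟨Finset.mem_range.2 (by lia), Finset.mem_Icc.2 ⟨hk1, by lia⟩⟩, ?_, hL⟩
    exact hkn.trans hr

/-- If `i` and `j` are not close, the two-point function has no Walsh component of low order. -/
lemma walshComp_twoPoint_eq_zero {G : Finset (Finset (Fin N))} (hG : ∀ e ∈ G, 2 ≤ #e)
    {ρ : ℕ → ℝ → ℝ} (hodd : ∀ p x, ρ p (-x) = -ρ p x) {β : ℝ} {i j : Fin N} (hij : i ≠ j)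
    {r : ℕ} (hfar : ¬IsClose G r i j) {A : Finset (Finset (Fin N))} (hA : #A < r + 1)
    (J : Finset (Fin N) → ℝ) : walshComp A (twoPoint G ρ β i j) J = 0 := by
  by_contra hne
  obtain ⟨hAG, hpar⟩ := odd_degree_of_walshComp_twoPoint_ne_zero hodd hij hne
  exact hfar (isClose_of_odd_degree hAG hG (by lia) hpar)

/-! ### Short walks and lassos in the random hypergraph -/

section RandomHypergraph

variable {x : Finset (Fin N) → ℝ} {Δ : ℕ} {q : ℝ}

lemma measureReal_exists_edge_le (hx0 : ∀ e, 0 ≤ x e)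
    (hq : ∀ u w, u ≠ w → ∑ e with u ∈ e ∧ w ∈ e, x e ≤ q)
    (D : Finset (Finset (Fin N))) (u : Fin N)
    (S : Finset (Fin N) → Fin N → Set (Finset (Fin N) → Bool)) (c : Fin N → ℝ)
    (hc0 : ∀ v, 0 ≤ c v)
    (hS : ∀ e ∉ D, ∀ v ≠ u, (Measure.pi fun e => berBool (x e)).real
      {g | (∀ e' ∈ insert e D, g e' = true) ∧ g ∈ S e v} ≤ (∏ e' ∈ insert e D, x e') * c v) :
    (Measure.pi fun e => berBool (x e)).real {g | (∀ e ∈ D, g e = true) ∧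
      ∃ e ∉ D, ∃ v ≠ u, u ∈ e ∧ v ∈ e ∧ e ∈ edgesOf Δ g ∧ g ∈ S e v} ≤
      (∏ e ∈ D, x e) * ∑ v ∈ univ.erase u, q * c v := by
  have hsub : {g : Finset (Fin N) → Bool | (∀ e ∈ D, g e = true) ∧
      ∃ e ∉ D, ∃ v ≠ u, u ∈ e ∧ v ∈ e ∧ e ∈ edgesOf Δ g ∧ g ∈ S e v} ⊆
      ⋃ v ∈ univ.erase u, ⋃ e ∈ ({e | (u ∈ e ∧ v ∈ e) ∧ e ∉ D} : Finset (Finset (Fin N))),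
        {g | (∀ e' ∈ insert e D, g e' = true) ∧ g ∈ S e v} := by
    rintro g ⟨hg, e, heD, v, hvu, hue, hve, heG, hgS⟩
    simp only [Set.mem_iUnion]
    refine ⟨v, by simpa using hvu, e, by simp [hue, hve, heD], fun e' he' => ?_, hgS⟩
    rcases Finset.mem_insert.1 he' with rfl | he'
    · exact (Finset.mem_filter.1 heG).2.1
    · exact hg e' he'
  have hD0 : 0 ≤ ∏ e ∈ D, x e := Finset.prod_nonneg fun e _ => hx0 e
  refine (measureReal_mono hsub (measure_ne_top _ _)).trans ((measureReal_biUnion_finset_le _ _).trans ?_)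
  rw [Finset.mul_sum]
  refine Finset.sum_le_sum fun v hv => (measureReal_biUnion_finset_le _ _).trans ?_
  have hvu : v ≠ u := Finset.ne_of_mem_erase hv
  calc _ ≤ ∑ e with (u ∈ e ∧ v ∈ e) ∧ e ∉ D, (∏ e ∈ D, x e) * (x e * c v) := by
        refine Finset.sum_le_sum fun e he => ?_
        have heD := (Finset.mem_filter.1 he).2.2
        refine (hS e heD v hvu).trans_eq ?_
        rw [Finset.prod_insert heD]
        ring
    _ ≤ ∑ e with u ∈ e ∧ v ∈ e, (∏ e ∈ D, x e) * (x e * c v) := by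
        refine Finset.sum_le_sum_of_subset_of_nonneg (fun e he => ?_) fun e _ _ =>
          mul_nonneg hD0 (mul_nonneg (hx0 e) (hc0 v))
        exact Finset.mem_filter.2 ⟨Finset.mem_univ _, (Finset.mem_filter.1 he).2.1⟩
    _ = (∏ e ∈ D, x e) * ((∑ e with u ∈ e ∧ v ∈ e, x e) * c v) := by
        rw [← Finset.mul_sum, ← Finset.sum_mul]
    _ ≤ _ := mul_le_mul_of_nonneg_left
        (mul_le_mul_of_nonneg_right (hq u v hvu.symm) (hc0 v)) hD0

lemma sum_erase_const (u : Fin N) (c : ℝ) :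
    ∑ _v ∈ univ.erase u, c = ((N : ℝ) - 1) * c := by
  have hN : 1 ≤ N := Nat.one_le_iff_ne_zero.2 (by rintro rfl; exact u.elim0)
  rw [Finset.sum_const, Finset.card_erase_of_mem (Finset.mem_univ u), Finset.card_univ,
    Fintype.card_fin, nsmul_eq_mul, Nat.cast_sub hN, Nat.cast_one]

lemma measureReal_isTrail_le (hx0 : ∀ e, 0 ≤ x e) (hx1 : ∀ e, x e ≤ 1) (hq0 : 0 ≤ q)
    (hq : ∀ u w, u ≠ w → ∑ e with u ∈ e ∧ w ∈ e, x e ≤ q) (hN : 1 ≤ N) (k : ℕ) (w : Fin N) :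
    ∀ (D : Finset (Finset (Fin N))) (u : Fin N), (Measure.pi fun e => berBool (x e)).real
      {g | (∀ e ∈ D, g e = true) ∧ IsTrail (edgesOf Δ g) D (k + 1) u w} ≤
      (∏ e ∈ D, x e) * (q * (((N : ℝ) - 1) * q) ^ k) := by
  have hD0 : ∀ D : Finset (Finset (Fin N)), 0 ≤ ∏ e ∈ D, x e :=
    fun D => Finset.prod_nonneg fun e _ => hx0 e
  have hN' : (0 : ℝ) ≤ N - 1 := by
    rw [sub_nonneg]
    exact_mod_cast hN
  have := fun e => isProbabilityMeasure_berBool (hx0 e) (hx1 e)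
  induction k with
  | zero =>
    intro D u
    refine (measureReal_exists_edge_le hx0 hq D u (fun e v => {_g | v = w})
      (fun v => if v = w then 1 else 0) (fun v => by positivity) fun e he v hv => ?_).trans ?_
    · by_cases h : v = w
      · simpa [h] using (pi_berBool_real_subset hx0 hx1 (insert e D)).le
      · simp [h]
    · refine mul_le_mul_of_nonneg_left ?_ (hD0 D)
      simp only [mul_ite, mul_one, mul_zero, pow_zero, Finset.sum_ite_eq']
      split_ifs <;> simp [hq0]
  | succ k ih =>
    intro D u
    refine (measureReal_exists_edge_le hx0 hq D u
      (fun e v => {g | IsTrail (edgesOf Δ g) (insert e D) (k + 1) v w})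
      (fun v => q * (((N : ℝ) - 1) * q) ^ k) (fun v => by positivity)
      fun e he v hv => ih (insert e D) v).trans_eq ?_
    rw [sum_erase_const]
    ring

lemma measureReal_isLasso_le (hx0 : ∀ e, 0 ≤ x e) (hx1 : ∀ e, x e ≤ 1) (hq0 : 0 ≤ q)
    (hq : ∀ u w, u ≠ w → ∑ e with u ∈ e ∧ w ∈ e, x e ≤ q) (hN : 1 ≤ N)
    (hΔ : ∀ e, x e ≠ 0 → #e ≤ Δ) (k a : ℕ) :
    ∀ (D : Finset (Finset (Fin N))) (u : Fin N), (Measure.pi fun e => berBool (x e)).real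
      {g | (∀ e ∈ D, g e = true) ∧ IsLasso (edgesOf Δ g) D a (k + 1) u} ≤
      (∏ e ∈ D, x e) * (Δ * (q * (((N : ℝ) - 1) * q) ^ (k + 1 + a))) := by
  have hD0 : ∀ D : Finset (Finset (Fin N)), 0 ≤ ∏ e ∈ D, x e :=
    fun D => Finset.prod_nonneg fun e _ => hx0 e
  have hN' : (0 : ℝ) ≤ N - 1 := by
    rw [sub_nonneg]
    exact_mod_cast hN
  have := fun e => isProbabilityMeasure_berBool (hx0 e) (hx1 e)
  induction a with
  | zero =>
    intro D u
    refine (measureReal_exists_edge_le hx0 hq D u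
      (fun e v => {g | ∃ w ∈ e, IsTrail (edgesOf Δ g) (insert e D) (k + 1) v w})
      (fun v => Δ * (q * (((N : ℝ) - 1) * q) ^ k)) (fun v => by positivity)
      fun e he v hv => ?_).trans_eq ?_
    · have hsub : {g : Finset (Fin N) → Bool | (∀ e' ∈ insert e D, g e' = true) ∧
          ∃ w ∈ e, IsTrail (edgesOf Δ g) (insert e D) (k + 1) v w} ⊆
          ⋃ w ∈ e, {g | (∀ e' ∈ insert e D, g e' = true) ∧
            IsTrail (edgesOf Δ g) (insert e D) (k + 1) v w} := by
        rintro g ⟨hg, w, hw, hT⟩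
        simp only [Set.mem_iUnion]
        exact ⟨w, hw, hg, hT⟩
      refine (measureReal_mono hsub (measure_ne_top _ _)).trans ((measureReal_biUnion_finset_le _ _).trans ?_)
      refine (Finset.sum_le_card_nsmul _ _ _ fun w _ =>
        measureReal_isTrail_le hx0 hx1 hq0 hq hN k w (insert e D) v).trans ?_
      rw [nsmul_eq_mul, mul_left_comm]
      by_cases hxe : x e = 0
      · simp [Finset.prod_insert he, hxe]
      · refine mul_le_mul_of_nonneg_left (mul_le_mul_of_nonneg_right ?_ (by positivity)) (hD0 _)
        exact_mod_cast hΔ e hxe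
    · rw [sum_erase_const]
      ring
  | succ a ih =>
    intro D u
    refine (measureReal_exists_edge_le hx0 hq D u
      (fun e v => {g | IsLasso (edgesOf Δ g) (insert e D) a (k + 1) v})
      (fun v => Δ * (q * (((N : ℝ) - 1) * q) ^ (k + 1 + a))) (fun v => by positivity)
      fun e he v hv => ih (insert e D) v).trans_eq ?_
    rw [sum_erase_const]
    ring

lemma measureReal_isClose_le (hx0 : ∀ e, 0 ≤ x e) (hx1 : ∀ e, x e ≤ 1)
    {L : ℝ} (hL : 1 ≤ L) (hN : 2 ≤ N)
    (hq : ∀ u w, u ≠ w → ∑ e with u ∈ e ∧ w ∈ e, x e ≤ L / (N - 1))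
    (hΔ : ∀ e, x e ≠ 0 → #e ≤ Δ) (r : ℕ) (i j : Fin N) :
    (Measure.pi fun e => berBool (x e)).real {g | IsClose (edgesOf Δ g) r i j} ≤
      (r + Δ * (r : ℝ) ^ 2) * L ^ r / (N - 1) := by
  have hN' : (0 : ℝ) < N - 1 := by
    rw [sub_pos]
    exact_mod_cast hN
  have hL0 : 0 < L := by linarith
  have hq0 : 0 ≤ L / ((N : ℝ) - 1) := by positivity
  have hLq : ((N : ℝ) - 1) * (L / (N - 1)) = L := by field_simp
  have hpow : ∀ n, n + 1 ≤ r → L / ((N : ℝ) - 1) * L ^ n ≤ L ^ r / (N - 1) := fun n hn => by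
    rw [div_mul_eq_mul_div, ← pow_succ']
    gcongr
  have hsub : {g : Finset (Fin N) → Bool | IsClose (edgesOf Δ g) r i j} ⊆
      (⋃ k ∈ Finset.Icc 1 r, {g | IsTrail (edgesOf Δ g) ∅ k i j}) ∪
      ⋃ p ∈ {p ∈ Finset.range r ×ˢ Finset.Icc 1 r | p.1 + 1 + p.2 ≤ r},
        {g | IsLasso (edgesOf Δ g) ∅ p.1 p.2 i} := by
    rintro g (⟨k, hk, hT⟩ | ⟨p, hp, hpr, hL⟩)
    · refine Or.inl ?_
      simp only [Set.mem_iUnion]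
      exact ⟨k, hk, hT⟩
    · refine Or.inr ?_
      simp only [Set.mem_iUnion]
      exact ⟨p, Finset.mem_filter.2 ⟨hp, hpr⟩, hL⟩
  have := fun e => isProbabilityMeasure_berBool (hx0 e) (hx1 e)
  refine (measureReal_mono hsub (measure_ne_top _ _)).trans ((measureReal_union_le _ _).trans ?_)
  have h1 : (Measure.pi fun e => berBool (x e)).real
      (⋃ k ∈ Finset.Icc 1 r, {g | IsTrail (edgesOf Δ g) ∅ k i j}) ≤ r * (L ^ r / (N - 1)) := by
    refine (measureReal_biUnion_finset_le _ _).trans ?_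
    refine (Finset.sum_le_card_nsmul _ _ (L ^ r / (N - 1)) fun k hk => ?_).trans_eq ?_
    · obtain ⟨hk1, hkr⟩ := Finset.mem_Icc.1 hk
      obtain ⟨k, rfl⟩ := Nat.exists_eq_add_of_le' hk1
      have := measureReal_isTrail_le (Δ := Δ) hx0 hx1 hq0 hq (by lia) k j ∅ i
      simp only [Finset.notMem_empty, false_imp_iff, implies_true, true_and, Finset.prod_empty,
        one_mul, hLq] at this
      exact this.trans (hpow k hkr)
    · simp
  have h2 : (Measure.pi fun e => berBool (x e)).real
      (⋃ p ∈ {p ∈ Finset.range r ×ˢ Finset.Icc 1 r | p.1 + 1 + p.2 ≤ r},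
        {g | IsLasso (edgesOf Δ g) ∅ p.1 p.2 i}) ≤ (r : ℝ) ^ 2 * (Δ * (L ^ r / (N - 1))) := by
    refine (measureReal_biUnion_finset_le _ _).trans ?_
    refine (Finset.sum_le_card_nsmul _ _ (Δ * (L ^ r / (N - 1))) fun p hp => ?_).trans ?_
    · obtain ⟨hp, hpr⟩ := Finset.mem_filter.1 hp
      obtain ⟨a, k⟩ := p
      obtain ⟨hk1, -⟩ := Finset.mem_Icc.1 (Finset.mem_product.1 hp).2
      obtain ⟨k, rfl⟩ : ∃ k', k = k' + 1 := Nat.exists_eq_add_of_le' hk1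
      have := measureReal_isLasso_le (Δ := Δ) hx0 hx1 hq0 hq (by lia) hΔ k a ∅ i
      simp only [Finset.notMem_empty, false_imp_iff, implies_true, true_and, Finset.prod_empty,
        one_mul, hLq] at this
      refine this.trans (mul_le_mul_of_nonneg_left (hpow _ ?_) (Nat.cast_nonneg _))
      simp only at hpr
      lia
    · rw [nsmul_eq_mul]
      refine mul_le_mul_of_nonneg_right ?_ (by positivity)
      refine (Nat.cast_le.2 (Finset.card_filter_le _ _)).trans_eq ?_
      simp [sq]
  refine (add_le_add h1 h2).trans_eq ?_
  ring

end RandomHypergraph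

/-! ### Edge probabilities of the diluted model -/

section EdgeProb

variable {α : ℕ → ℝ} {Δ : ℕ}

lemma edgeProb_nonneg (hα : ∀ p, 2 ≤ p → p ≤ Δ → 0 < α p) (e : Finset (Fin N)) :
    0 ≤ edgeProb α Δ N e := by
  unfold edgeProb
  split_ifs with h
  · have := hα _ h.1 h.2
    positivity
  · exact le_rfl

lemma edgeProb_le_one (hN : ∀ p, 2 ≤ p → p ≤ Δ → α p * N ≤ (N.choose p : ℝ))
    (e : Finset (Fin N)) : edgeProb α Δ N e ≤ 1 := by
  unfold edgeProb
  split_ifs with h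
  · exact div_le_one_of_le₀ (hN _ h.1 h.2) (Nat.cast_nonneg _)
  · exact zero_le_one

lemma card_le_of_edgeProb_ne_zero (e : Finset (Fin N)) (h : edgeProb α Δ N e ≠ 0) : #e ≤ Δ := by
  by_contra hlt
  exact h (if_neg fun h' => hlt h'.2)

lemma card_edges_through_pair_le {u w : Fin N} (huw : u ≠ w) (p : ℕ) :
    #{e : Finset (Fin N) | (u ∈ e ∧ w ∈ e) ∧ #e = p} ≤ (N - 2).choose (p - 2) := by
  have hcard : #((univ.erase u).erase w) = N - 2 := by
    rw [Finset.card_erase_of_mem (by simp [huw.symm]), Finset.card_erase_of_mem (by simp),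
      Finset.card_univ, Fintype.card_fin]
    rfl
  rw [← hcard, ← Finset.card_powersetCard]
  refine Finset.card_le_card_of_injOn (fun e => (e.erase u).erase w) (fun e he => ?_) ?_
  · obtain ⟨-, ⟨hu, hw⟩, hp⟩ := Finset.mem_filter.1 he
    refine Finset.mem_coe.2 (Finset.mem_powersetCard.2
      ⟨Finset.erase_subset_erase _ (Finset.erase_subset_erase _ (Finset.subset_univ e)), ?_⟩)
    rw [Finset.card_erase_of_mem (by simp [huw.symm, hw]), Finset.card_erase_of_mem hu, hp]
    rfl
  · intro e he e' he' h
    obtain ⟨-, ⟨hu, hw⟩, -⟩ := Finset.mem_filter.1 he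
    obtain ⟨-, ⟨hu', hw'⟩, -⟩ := Finset.mem_filter.1 he'
    have h' : (e.erase u).erase w = (e'.erase u).erase w := h
    rw [← Finset.insert_erase hu, ← Finset.insert_erase hu',
      ← Finset.insert_erase (show w ∈ e.erase u by simp [huw.symm, hw]),
      ← Finset.insert_erase (show w ∈ e'.erase u by simp [huw.symm, hw']), h']

lemma choose_mul_pred_mul (n k : ℕ) :
    ((n + 2).choose (k + 2) : ℝ) * ((k + 2) * (k + 1)) = (n + 2) * (n + 1) * n.choose k := by
  have h1 := Nat.add_one_mul_choose_eq n k
  have h2 := Nat.add_one_mul_choose_eq (n + 1) (k + 1)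
  have h1' : ((n : ℝ) + 1) * n.choose k = (n + 1).choose (k + 1) * (k + 1) := by exact_mod_cast h1
  have h2' : ((n : ℝ) + 1 + 1) * (n + 1).choose (k + 1) =
      (n + 2).choose (k + 2) * (k + 1 + 1) := by exact_mod_cast h2
  linear_combination (-(n : ℝ) - 2) * h1' - ((k : ℝ) + 1) * h2'

lemma sum_edgeProb_le (hα : ∀ p, 2 ≤ p → p ≤ Δ → 0 < α p) (hN2 : 2 ≤ N)
    (hN : ∀ p, 2 ≤ p → p ≤ Δ → α p * N ≤ (N.choose p : ℝ)) {u w : Fin N} (huw : u ≠ w) :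
    ∑ e with u ∈ e ∧ w ∈ e, edgeProb α Δ N e ≤ lamMix α Δ / (N - 1) := by
  have hN0 : (0 : ℝ) < N := by exact_mod_cast (by lia : 0 < N)
  have hN1 : (0 : ℝ) < N - 1 := by
    rw [sub_pos]
    exact_mod_cast hN2
  have hsum : ∑ e with u ∈ e ∧ w ∈ e, edgeProb α Δ N e =
      ∑ p ∈ Finset.Icc 2 Δ, ∑ e with (u ∈ e ∧ w ∈ e) ∧ #e = p, α p * N / N.choose p := by
    have hmap : ∀ e ∈ ({e | (u ∈ e ∧ w ∈ e) ∧ #e ∈ Finset.Icc 2 Δ} : Finset (Finset (Fin N))),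
        #e ∈ Finset.Icc 2 Δ := fun e he => (Finset.mem_filter.1 he).2.2
    calc _ = ∑ e with (u ∈ e ∧ w ∈ e) ∧ #e ∈ Finset.Icc 2 Δ, α #e * N / N.choose #e := by
          rw [← Finset.filter_filter _ (fun e => #e ∈ Finset.Icc 2 Δ)]
          simp only [edgeProb, Finset.mem_Icc]
          exact (Finset.sum_filter _ _).symm
      _ = _ := by
          rw [← Finset.sum_fiberwise_of_maps_to hmap]
          refine Finset.sum_congr rfl fun p hp => ?_
          rw [Finset.filter_filter]
          refine Finset.sum_congr (Finset.filter_congr fun e _ => ?_) fun e he => ?_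
          · constructor
            · rintro ⟨⟨h, -⟩, h'⟩
              exact ⟨h, h'⟩
            · rintro ⟨h, rfl⟩
              exact ⟨⟨h, hp⟩, rfl⟩
          · rw [(Finset.mem_filter.1 he).2.2]
  rw [hsum, lamMix, Finset.sum_div]
  refine Finset.sum_le_sum fun p hp => ?_
  obtain ⟨hp2, hpΔ⟩ := Finset.mem_Icc.1 hp
  have hαp := hα p hp2 hpΔ
  have hch : (0 : ℝ) < N.choose p := (mul_pos hαp hN0).trans_le (hN p hp2 hpΔ)
  rw [Finset.sum_const, nsmul_eq_mul]
  calc _ ≤ ((N - 2).choose (p - 2) : ℝ) * (α p * N / N.choose p) := by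
        refine mul_le_mul_of_nonneg_right ?_ (by positivity)
        exact_mod_cast card_edges_through_pair_le huw p
    _ = _ := by
        obtain ⟨n, rfl⟩ := Nat.exists_eq_add_of_le' hN2
        obtain ⟨k, rfl⟩ := Nat.exists_eq_add_of_le' hp2
        have := choose_mul_pred_mul n k
        rw [mul_div_assoc', div_eq_div_iff hch.ne' hN1.ne']
        push_cast
        linear_combination (-α (k + 2)) * this

end EdgeProb

/-! ### Averaging over the graph and the disorder -/

/-- The product of the two-point functions of the disorders `X` and `Y` on a common graph. -/
def pairCorr {Ω : Type*} (X Y : Ω → Finset (Fin N) → ℝ) (Δ : ℕ) (ρ : ℕ → ℝ → ℝ) (β : ℝ)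
    (i j : Fin N) (ω : (Finset (Fin N) → Bool) × Ω) : ℝ :=
  twoPoint (edgesOf Δ ω.1) ρ β i j (X ω.2) * twoPoint (edgesOf Δ ω.1) ρ β i j (Y ω.2)

lemma abs_pairCorr_le {Ω : Type*} (X Y : Ω → Finset (Fin N) → ℝ) (Δ : ℕ) (ρ : ℕ → ℝ → ℝ) (β : ℝ)
    (i j : Fin N) (ω : (Finset (Fin N) → Bool) × Ω) :
    |pairCorr X Y Δ ρ β i j ω| ≤ 1 :=
  abs_mul_le_one (abs_twoPoint_le _ _ _ _ _ _) (abs_twoPoint_le _ _ _ _ _ _)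

section Average

variable {Ω : Type*} [MeasurableSpace Ω] {X Y : Ω → Finset (Fin N) → ℝ} {α : ℕ → ℝ} {Δ : ℕ}
  {ρ : ℕ → ℝ → ℝ}

lemma measurable_pairCorr (hX : Measurable X) (hY : Measurable Y) (hρ : ∀ p, Measurable (ρ p))
    (β : ℝ) (i j : Fin N) : Measurable (pairCorr X Y Δ ρ β i j) := by
  refine measurable_from_prod_countable_right fun g => ?_
  exact ((measurable_twoPoint (edgesOf Δ g) hρ β i j).comp hX).mul
    ((measurable_twoPoint (edgesOf Δ g) hρ β i j).comp hY)

lemma isProbabilityMeasure_graphMeasure (hα : ∀ p, 2 ≤ p → p ≤ Δ → 0 < α p)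
    (hN : ∀ p, 2 ≤ p → p ≤ Δ → α p * N ≤ (N.choose p : ℝ)) :
    IsProbabilityMeasure (graphMeasure α Δ N) := by
  have := fun e => isProbabilityMeasure_berBool (edgeProb_nonneg (N := N) hα e)
    (edgeProb_le_one hN e)
  unfold graphMeasure
  infer_instance

lemma integral_pairCorr_le (ν : Measure Ω) [IsProbabilityMeasure ν] (hX : Measurable X)
    (hY : Measurable Y) {a : ℝ} (ha : 0 ≤ a)
    (hXY : ∀ φ : (Finset (Fin N) → ℝ) → ℝ, Measurable φ → (∀ x, |φ x| ≤ 1) →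
      ∀ m : ℕ, (∀ A, #A < m → ∀ x, walshComp A φ x = 0) → ∫ ω, φ (X ω) * φ (Y ω) ∂ν ≤ a ^ m)
    (hα : ∀ p, 2 ≤ p → p ≤ Δ → 0 < α p) (hlam : 1 ≤ lamMix α Δ)
    (hN2 : 2 ≤ N) (hN : ∀ p, 2 ≤ p → p ≤ Δ → α p * N ≤ (N.choose p : ℝ))
    (hρ : ∀ p, Measurable (ρ p)) (hodd : ∀ p x, ρ p (-x) = -ρ p x)
    (β : ℝ) (r : ℕ) {i j : Fin N} (hij : i ≠ j) :
    ∫ ω, pairCorr X Y Δ ρ β i j ω ∂((graphMeasure α Δ N).prod ν) ≤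
      (r + Δ * (r : ℝ) ^ 2) * lamMix α Δ ^ r / (N - 1) + a ^ (r + 1) := by
  have := isProbabilityMeasure_graphMeasure hα hN
  rw [integral_prod _ (integrable_of_abs_le_one (measurable_pairCorr hX hY hρ β i j)
    (abs_pairCorr_le X Y Δ ρ β i j))]
  set S : Set (Finset (Fin N) → Bool) := {g | IsClose (edgesOf Δ g) r i j} with hS
  have hSm : MeasurableSet S := S.toFinite.measurableSet
  have hpt : ∀ g, ∫ ω, pairCorr X Y Δ ρ β i j (g, ω) ∂ν ≤ S.indicator 1 g + a ^ (r + 1) := by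
    intro g
    have hvan := hXY (twoPoint (edgesOf Δ g) ρ β i j) (measurable_twoPoint _ hρ β i j)
      (abs_twoPoint_le _ _ _ _ _)
    by_cases hg : g ∈ S
    · rw [Set.indicator_of_mem hg]
      refine (hvan 0 fun A hA => absurd hA (Nat.not_lt_zero _)).trans ?_
      have := pow_nonneg ha (r + 1)
      rw [pow_zero, Pi.one_apply]
      linarith
    · rw [Set.indicator_of_notMem hg, zero_add]
      exact hvan (r + 1) fun A hA => walshComp_twoPoint_eq_zero
        (fun e he => (Finset.mem_filter.1 he).2.2.1) hodd hij hg hA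
  have hSr : (graphMeasure α Δ N).real S ≤
      (r + Δ * (r : ℝ) ^ 2) * lamMix α Δ ^ r / (N - 1) :=
    measureReal_isClose_le (edgeProb_nonneg hα) (edgeProb_le_one hN) hlam hN2
      (fun u w huw => sum_edgeProb_le hα hN2 hN huw) card_le_of_edgeProb_ne_zero r i j
  calc _ ≤ ∫ g, (S.indicator 1 g + a ^ (r + 1)) ∂graphMeasure α Δ N :=
        integral_mono .of_finite .of_finite hpt
    _ = (graphMeasure α Δ N).real S + a ^ (r + 1) := by
        rw [integral_add .of_finite .of_finite, integral_indicator_one hSm, integral_const,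
          probReal_univ, one_smul]
    _ ≤ _ := by gcongr

lemma integral_overlap_sq_le (ν : Measure Ω) [IsProbabilityMeasure ν] (hX : Measurable X)
    (hY : Measurable Y) {a : ℝ} (ha : 0 ≤ a)
    (hXY : ∀ φ : (Finset (Fin N) → ℝ) → ℝ, Measurable φ → (∀ x, |φ x| ≤ 1) →
      ∀ m : ℕ, (∀ A, #A < m → ∀ x, walshComp A φ x = 0) → ∫ ω, φ (X ω) * φ (Y ω) ∂ν ≤ a ^ m)
    (hα : ∀ p, 2 ≤ p → p ≤ Δ → 0 < α p) (hlam : 1 ≤ lamMix α Δ)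
    (hN2 : 2 ≤ N) (hN : ∀ p, 2 ≤ p → p ≤ Δ → α p * N ≤ (N.choose p : ℝ))
    (hρ : ∀ p, Measurable (ρ p)) (hodd : ∀ p x, ρ p (-x) = -ρ p x) (β : ℝ) (r : ℕ) :
    ∫ ω : (Finset (Fin N) → Bool) × Ω, gibbs2 β (ham (edgesOf Δ ω.1) ρ (X ω.2))
        (ham (edgesOf Δ ω.1) ρ (Y ω.2)) (fun σ τ => overlap σ τ ^ 2)
        ∂((graphMeasure α Δ N).prod ν) ≤
      1 / N + (r + Δ * (r : ℝ) ^ 2) * lamMix α Δ ^ r / (N - 1) + a ^ (r + 1) := by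
  have := isProbabilityMeasure_graphMeasure hα hN
  have hN0 : (0 : ℝ) < N := by exact_mod_cast (by lia : 0 < N)
  have hN1 : (0 : ℝ) < N - 1 := by
    rw [sub_pos]
    exact_mod_cast hN2
  have hinteg : ∀ i j, Integrable (pairCorr X Y Δ ρ β i j) ((graphMeasure α Δ N).prod ν) :=
    fun i j => integrable_of_abs_le_one (measurable_pairCorr hX hY hρ β i j)
      (abs_pairCorr_le X Y Δ ρ β i j)
  have hle : ∀ i j : Fin N, ∫ ω, pairCorr X Y Δ ρ β i j ω ∂((graphMeasure α Δ N).prod ν) ≤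
      (if i = j then 1 else 0) +
        ((r + Δ * (r : ℝ) ^ 2) * lamMix α Δ ^ r / (N - 1) + a ^ (r + 1)) := by
    intro i j
    split_ifs with hij
    · refine (integral_mono (hinteg i j) (integrable_const 1)
        fun ω => (abs_le.1 (abs_pairCorr_le X Y Δ ρ β i j ω)).2).trans ?_
      rw [integral_const, probReal_univ, one_smul, le_add_iff_nonneg_right]
      have := zero_le_one.trans hlam
      positivity
    · rw [zero_add]
      exact integral_pairCorr_le ν hX hY ha hXY hα hlam hN2 hN hρ hodd β r hij
  have heq : ∀ ω : (Finset (Fin N) → Bool) × Ω, gibbs2 β (ham (edgesOf Δ ω.1) ρ (X ω.2))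
      (ham (edgesOf Δ ω.1) ρ (Y ω.2)) (fun σ τ => overlap σ τ ^ 2) =
      (∑ i, ∑ j, pairCorr X Y Δ ρ β i j ω) / (N : ℝ) ^ 2 := fun ω => gibbs2_overlap_sq _ _ _ _ _
  simp only [heq]
  rw [integral_div, integral_finsetSum _ fun i _ => integrable_finsetSum _ fun j _ =>
    hinteg i j]
  simp only [integral_finsetSum _ fun j _ => hinteg _ j]
  calc _ ≤ (∑ i : Fin N, ∑ j : Fin N, ((if i = j then (1 : ℝ) else 0) +
        ((r + Δ * (r : ℝ) ^ 2) * lamMix α Δ ^ r / (N - 1) + a ^ (r + 1)))) / (N : ℝ) ^ 2 := by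
        gcongr with i _ j _
        exact hle i j
    _ = _ := by
        simp only [Finset.sum_add_distrib, Finset.sum_ite_eq, Finset.mem_univ, if_true,
          Finset.sum_const, Finset.card_univ, Fintype.card_fin, nsmul_eq_mul]
        field_simp
        ring

end Average

lemma error_terms_le {L : ℝ} (hL : 1 < L) {N : ℕ} (hN : 2 ≤ N) (Δ : ℕ) {t : ℝ} (ht : 0 ≤ t) :
    ∃ r : ℕ, 1 / (N : ℝ) + (r + Δ * (r : ℝ) ^ 2) * L ^ r / (N - 1) + exp (-t) ^ (r + 1) ≤
      (2 + 8 * (1 + Δ) / log L ^ 2) / (N : ℝ) ^ (t / (t + 2 * log L)) := by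
  have hN0 : (0 : ℝ) < N := by exact_mod_cast (by lia : 0 < N)
  have hN2 : (2 : ℝ) ≤ N := by exact_mod_cast hN
  have hl : 0 < log L := log_pos hL
  have hX : 0 ≤ log (N : ℝ) := log_nonneg (by linarith)
  have hd : 0 < t + 2 * log L := by linarith
  set s : ℝ := log N / (t + 2 * log L) with hs
  have hs0 : 0 ≤ s := by positivity
  have hsX : (t + 2 * log L) * s = log N := by
    rw [hs]
    field_simp
  have hpow : (N : ℝ) ^ (t / (t + 2 * log L)) = exp (t * s) := by
    rw [rpow_def_of_pos hN0, hs]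
    congr 1
    ring
  refine ⟨⌊s⌋₊, ?_⟩
  have hr1 : (⌊s⌋₊ : ℝ) ≤ s := Nat.floor_le hs0
  have hr2 : s < ⌊s⌋₊ + 1 := Nat.lt_floor_add_one s
  set r := ⌊s⌋₊
  rw [hpow, div_eq_mul_inv _ (exp _), ← exp_neg]
  have h1 : 1 / (N : ℝ) ≤ exp (-(t * s)) := by
    rw [one_div, ← exp_log hN0, ← exp_neg, exp_le_exp, ← hsX]
    nlinarith
  have h3 : exp (-t) ^ (r + 1) ≤ exp (-(t * s)) := by
    rw [← exp_nat_mul, exp_le_exp]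
    push_cast
    nlinarith
  have h2 : (r + Δ * (r : ℝ) ^ 2) * L ^ r / (N - 1) ≤
      8 * (1 + Δ) / log L ^ 2 * exp (-(t * s)) := by
    have hLr : L ^ r = exp (r * log L) := by
      rw [exp_nat_mul, exp_log (by linarith)]
    have hrr : (r : ℝ) ≤ (r : ℝ) ^ 2 := by exact_mod_cast Nat.le_self_pow two_ne_zero r
    have hsq : (r : ℝ) ^ 2 ≤ 4 / log L ^ 2 * exp (r * log L) := by
      have h := (lt_add_one _).le.trans (add_one_le_exp (r * log L / 2))
      have h' := pow_le_pow_left₀ (by positivity) h 2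
      rw [← exp_nat_mul] at h'
      have he : ((2 : ℕ) : ℝ) * (r * log L / 2) = r * log L := by
        push_cast
        ring
      rw [he] at h'
      rw [div_mul_eq_mul_div, le_div_iff₀ (by positivity)]
      linarith
    have hinv : 1 / ((N : ℝ) - 1) ≤ 2 * exp (-log N) := by
      rw [exp_neg, exp_log hN0, ← div_eq_mul_inv, div_le_div_iff₀ (by linarith) hN0]
      linarith
    calc _ = (r + Δ * (r : ℝ) ^ 2) * exp (r * log L) * (1 / (N - 1)) := by
          rw [hLr]
          ring
      _ ≤ ((1 + Δ) * (4 / log L ^ 2 * exp (r * log L))) * exp (r * log L) *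
          (2 * exp (-log N)) := by
          have hD : (0 : ℝ) ≤ 1 / (N - 1) := one_div_nonneg.2 (by linarith)
          gcongr
          calc _ ≤ (1 + Δ) * (r : ℝ) ^ 2 := by linarith
            _ ≤ _ := by gcongr
      _ = 8 * (1 + Δ) / log L ^ 2 * exp (r * log L + r * log L + -log N) := by
          rw [exp_add, exp_add]
          ring
      _ ≤ _ := by
          gcongr
          rw [← hsX]
          nlinarith
  linarith

lemma two_le_of_choose {α : ℕ → ℝ} {Δ : ℕ} (hΔ : 2 ≤ Δ)
    (hα : ∀ p, 2 ≤ p → p ≤ Δ → 0 < α p) (hN1 : 1 ≤ N)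
    (hN : ∀ p, 2 ≤ p → p ≤ Δ → α p * N ≤ (N.choose p : ℝ)) : 2 ≤ N := by
  by_contra h
  obtain rfl : N = 1 := by lia
  have h2 := hN 2 le_rfl hΔ
  have := hα 2 le_rfl hΔ
  norm_num at h2
  linarith

/-- Disorder chaos in the diluted mixed `p`-spin model: if `λ > 1`, there
is a constant `C = C((α_p)) > 0` such that for both perturbations,
`E⟨R(σ,τ)²⟩_t ≤ C / N^{t/(t + 2 log λ)}`, `E` averaging over graph and disorder. -/
theorem stmt9 (Δ : ℕ) (hΔ : 2 ≤ Δ) (α : ℕ → ℝ)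
    (hα : ∀ p, 2 ≤ p → p ≤ Δ → 0 < α p) (hlam : 1 < lamMix α Δ) :
    ∃ C > 0, ∀ N : ℕ, 1 ≤ N →
      (∀ p, 2 ≤ p → p ≤ Δ → α p * N ≤ (N.choose p : ℝ)) →
      ∀ ρ : ℕ → ℝ → ℝ, (∀ p, Measurable (ρ p)) → (∀ p x, ρ p (-x) = - ρ p x) →
      ∀ t β : ℝ, 0 ≤ t → 0 ≤ β →
        dilContExp α Δ N ρ β t (fun σ τ => overlap σ τ ^ 2)
            ≤ C / (N : ℝ) ^ (t / (t + 2 * Real.log (lamMix α Δ))) ∧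
          dilDiscExp α Δ N ρ β t (fun σ τ => overlap σ τ ^ 2)
            ≤ C / (N : ℝ) ^ (t / (t + 2 * Real.log (lamMix α Δ))) := by

  have hl : 0 < log (lamMix α Δ) := log_pos hlam
  refine ⟨2 + 8 * (1 + Δ) / log (lamMix α Δ) ^ 2, by positivity, ?_⟩
  intro N hN1 hN ρ hρ hodd t β ht _
  have hN2 := two_le_of_choose hΔ hα hN1 hN
  obtain ⟨r, hr⟩ := error_terms_le hlam hN2 Δ ht
  constructor
  · have : IsProbabilityMeasure (pairGauss (Finset (Fin N))) := by
      unfold pairGauss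
      infer_instance
    have hY : Measurable fun ω : (Finset (Fin N) → ℝ) × (Finset (Fin N) → ℝ) =>
        contPerturb t ω.1 ω.2 := measurable_ouMap_prod _ _
    have h := integral_overlap_sq_le (pairGauss (Finset (Fin N))) measurable_fst hY
      (exp_pos (-t)).le (fun φ hφ hφ1 m hm => integral_contPerturb_le_pow ht hφ hφ1 hm)
      hα hlam.le hN2 hN hρ hodd β r
    unfold dilContExp
    exact h.trans hr
  · have h1 : exp (-t) ≤ 1 := exp_le_one_iff.2 (neg_nonpos.2 ht)
    have := isProbabilityMeasure_berBool (exp_pos (-t)).le h1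
    have : IsProbabilityMeasure (tripleGaussBer (Finset (Fin N)) (exp (-t))) := by
      unfold tripleGaussBer
      infer_instance
    have h := integral_overlap_sq_le (tripleGaussBer (Finset (Fin N)) (exp (-t)))
      measurable_fst measurable_discPerturb (exp_pos (-t)).le
      (fun φ hφ hφ1 m hm => integral_discPerturb_le_pow (exp_pos _).le h1 hφ hφ1 hm)
      hα hlam.le hN2 hN hρ hodd β r
    unfold dilDiscExp
    exact h.trans hr
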